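/- arXiv:1806.04980 — 3 statements merged into one kernel-verified Lean document; each statement's English description precedes it below -/
import Mathlib

section
/- Let f(x) = a·x² + b·x + c be a quadratic polynomial with a, b, c ∈ ℚ and a ≠ 0, and let n ∈ {1, 2, 3}. Suppose that for every prime p, the polynomial f has a periodic point of exact period n in the field ℚ_p of p-adic numbers. Then f has a periodic point of exact period n in ℚ. -/
open NumberField Polynomial

/-- An embedding of a number field into `ℚ_[p]` maps algebraic integers to `p`-adic integers. -/
lemma exists_ringHom_padicInt {K : Type*} [Field K] {p : ℕ} [Fact p.Prime] (φ : K →+* ℚ_[p]) :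
    ∃ ψ : 𝓞 K →+* ℤ_[p], ∀ y, (ψ y : ℚ_[p]) = φ y := by
  have h : ∀ y : 𝓞 K, φ y ∈ PadicInt.subring p := by
    intro y
    have h1 : IsIntegral ℤ (φ y) := y.isIntegral_coe.map φ.toIntAlgHom
    have h2 : IsIntegral ℤ_[p] (φ y) := h1.tower_top
    obtain ⟨z, hz⟩ := IsIntegrallyClosed.isIntegral_iff.1 h2
    rw [← hz]
    exact z.2
  exact ⟨(φ.comp (algebraMap (𝓞 K) K)).codRestrict (PadicInt.subring p) h, fun y => rfl⟩

lemma RingHom.eq_of_ker_eq_zmod {R : Type*} [CommRing R] {p : ℕ} {f g : R →+* ZMod p}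
    (h : RingHom.ker f = RingHom.ker g) : f = g := by
  ext x
  have : x - ((f x).cast : ℤ) ∈ RingHom.ker f := by simp [RingHom.mem_ker]
  rw [h] at this
  exact (sub_eq_zero.1 (by simpa [RingHom.mem_ker] using this)).symm

lemma absNorm_ker {K : Type*} [Field K] [NumberField K] {p : ℕ} (f : 𝓞 K →+* ZMod p) :
    Ideal.absNorm (RingHom.ker f) = p := by
  have e := RingHom.quotientKerEquivOfSurjective (ZMod.ringHom_surjective f)
  rw [Ideal.absNorm_apply, Submodule.cardQuot_apply, Nat.card_congr e.toEquiv, Nat.card_zmod]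

open Filter Topology ENNReal

/-- The extended nonnegative real `n ^ (-s)`. -/
noncomputable def dirichletWeight (s : ℝ) (n : ℕ) : ℝ≥0∞ := ENNReal.ofReal ((n : ℝ) ^ (-s))

lemma dirichletWeight_mul (s : ℝ) (m n : ℕ) :
    dirichletWeight s (m * n) = dirichletWeight s m * dirichletWeight s n := by
  rw [dirichletWeight, dirichletWeight, dirichletWeight, ← ENNReal.ofReal_mul (by positivity), Nat.cast_mul,
    Real.mul_rpow (by positivity) (by positivity)]

lemma tsum_dirichletWeight_absNorm_eq (K : Type*) [Field K] [NumberField K] (s : ℝ) :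
    ∑' I : Ideal (𝓞 K), dirichletWeight s (Ideal.absNorm I) =
      ∑' n : ℕ, ENNReal.ofReal
        (Nat.card {I : Ideal (𝓞 K) // Ideal.absNorm I = n} * (n : ℝ) ^ (-s)) := by
  rw [← (Equiv.sigmaFiberEquiv (Ideal.absNorm (S := 𝓞 K))).tsum_eq, ENNReal.tsum_sigma']
  refine tsum_congr fun n => ?_
  have : Finite {I : Ideal (𝓞 K) // Ideal.absNorm I = n} := Ideal.finite_setOfPred_absNorm_eq n
  have h : ∀ I : {I : Ideal (𝓞 K) // Ideal.absNorm I = n},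
      dirichletWeight s (Ideal.absNorm (Equiv.sigmaFiberEquiv (Ideal.absNorm (S := 𝓞 K)) ⟨n, I⟩)) =
        dirichletWeight s n :=
    fun I => congrArg _ I.2
  rw [tsum_congr h, ENNReal.tsum_const, ENNReal.ofReal_mul (by positivity), ENNReal.ofReal_natCast,
    dirichletWeight, ENat.card_eq_coe_natCard, ENat.toENNReal_coe]

lemma exists_tsum_dirichletWeight_absNorm_le (K : Type*) [Field K] [NumberField K] :
    ∃ C : ℝ, 0 < C ∧ ∀ᶠ s in 𝓝[>] (1 : ℝ),
      ∑' I : Ideal (𝓞 K), dirichletWeight s (Ideal.absNorm I) ≤ ENNReal.ofReal (C / (s - 1)) := by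
  have hpos := dedekindZeta_residue_pos K
  have hlim := (tendsto_sub_one_mul_dedekindZeta_nhdsGT K).norm
  rw [Complex.norm_real, Real.norm_of_nonneg hpos.le] at hlim
  refine ⟨dedekindZeta_residue K + 1, by positivity, ?_⟩
  filter_upwards [hlim.eventually_lt_const (lt_add_one _), hlim.eventually_const_lt hpos,
    self_mem_nhdsWithin] with s hlt hgt hs
  have hs : 0 < s - 1 := sub_pos.2 hs
  have hterm : ∀ n : ℕ, LSeries.term
      (fun n ↦ (Nat.card {I : Ideal (𝓞 K) // Ideal.absNorm I = n} : ℂ)) s n =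
      ((Nat.card {I : Ideal (𝓞 K) // Ideal.absNorm I = n} * (n : ℝ) ^ (-s) : ℝ) : ℂ) := by
    intro n
    rcases eq_or_ne n 0 with rfl | hn
    · simp [Real.zero_rpow (show -s ≠ 0 by linarith)]
    · rw [LSeries.term_of_ne_zero hn, Real.rpow_neg (by positivity), div_eq_mul_inv]
      push_cast
      rw [Complex.ofReal_cpow (by positivity)]
      simp
  have hz : dedekindZeta K s = ((∑' n : ℕ,
      (Nat.card {I : Ideal (𝓞 K) // Ideal.absNorm I = n} * (n : ℝ) ^ (-s) : ℝ) : ℝ) : ℂ) := by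
    rw [dedekindZeta, LSeries, tsum_congr hterm, Complex.ofReal_tsum]
  have hnonneg : ∀ n : ℕ,
      0 ≤ (Nat.card {I : Ideal (𝓞 K) // Ideal.absNorm I = n} * (n : ℝ) ^ (-s) : ℝ) :=
    fun n => by positivity
  have hsum : Summable fun n : ℕ =>
      (Nat.card {I : Ideal (𝓞 K) // Ideal.absNorm I = n} * (n : ℝ) ^ (-s) : ℝ) := by
    by_contra hns
    rw [hz, tsum_eq_zero_of_not_summable hns] at hgt
    simp at hgt
  rw [tsum_dirichletWeight_absNorm_eq, ← ENNReal.ofReal_tsum_of_nonneg hnonneg hsum]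
  refine ENNReal.ofReal_le_ofReal ?_
  rw [hz, ← Complex.ofReal_one, ← Complex.ofReal_sub, ← Complex.ofReal_mul, Complex.norm_real,
    Real.norm_of_nonneg (mul_nonneg hs.le (tsum_nonneg hnonneg))] at hlt
  rw [le_div_iff₀ hs, mul_comm]
  exact hlt.le

lemma eventually_le_tsum_dirichletWeight {M : ℕ} (hM : M ≠ 0) :
    ∃ c : ℝ, 0 < c ∧ ∀ᶠ s in 𝓝[>] (1 : ℝ),
      ENNReal.ofReal (c / (s - 1)) ≤ ∑' n : ℕ, dirichletWeight s (M * n + 1) := by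
  have hM0 : (0 : ℝ) < M := by positivity
  have hc : (0 : ℝ) < (M : ℝ) ^ (-2 : ℝ) := Real.rpow_pos_of_pos hM0 _
  refine ⟨(M : ℝ) ^ (-2 : ℝ) * (1 / 2), by positivity, ?_⟩
  have h2 : ∀ᶠ s in 𝓝[>] (1 : ℝ), s < 2 :=
    eventually_nhdsWithin_of_eventually_nhds (eventually_lt_nhds (by norm_num))
  filter_upwards [tendsto_sub_mul_tsum_nat_rpow.eventually_const_lt (show (1 / 2 : ℝ) < 1 by norm_num),
    self_mem_nhdsWithin, h2] with s hgt hs hs2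
  have hs : 1 < s := hs
  have hs0 : 0 < s - 1 := sub_pos.2 hs
  have hsum : Summable fun n : ℕ => 1 / (n : ℝ) ^ s := Real.summable_one_div_nat_rpow.2 hs
  have h1 : ENNReal.ofReal (1 / 2 / (s - 1)) ≤ ∑' n : ℕ, dirichletWeight s n := by
    have : ∀ n : ℕ, dirichletWeight s n = ENNReal.ofReal (1 / (n : ℝ) ^ s) := fun n => by
      rw [dirichletWeight, Real.rpow_neg (by positivity), one_div]
    rw [tsum_congr this, ← ENNReal.ofReal_tsum_of_nonneg (fun n => by positivity) hsum]
    refine ENNReal.ofReal_le_ofReal ?_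
    rw [div_le_iff₀ hs0, mul_comm]
    exact hgt.le
  have h0 : dirichletWeight s 0 = 0 := by
    simp [dirichletWeight, Real.zero_rpow (show -s ≠ 0 by linarith)]
  rw [tsum_eq_zero_add' ENNReal.summable, h0, zero_add] at h1
  calc ENNReal.ofReal ((M : ℝ) ^ (-2 : ℝ) * (1 / 2) / (s - 1))
      = ENNReal.ofReal ((M : ℝ) ^ (-2 : ℝ)) * ENNReal.ofReal (1 / 2 / (s - 1)) := by
        rw [← ENNReal.ofReal_mul hc.le, mul_div_assoc]
    _ ≤ dirichletWeight s M * ∑' n : ℕ, dirichletWeight s (n + 1) := by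
        gcongr
        refine ENNReal.ofReal_le_ofReal (Real.rpow_le_rpow_of_exponent_le ?_ (by linarith))
        exact_mod_cast Nat.one_le_iff_ne_zero.2 hM
    _ = ∑' n : ℕ, dirichletWeight s (M * (n + 1)) := by
        rw [← ENNReal.tsum_mul_left]
        exact tsum_congr fun n => (dirichletWeight_mul _ _ _).symm
    _ ≤ ∑' n : ℕ, dirichletWeight s (M * n + 1) := by
        refine ENNReal.tsum_le_tsum fun n => ENNReal.ofReal_le_ofReal ?_
        refine Real.rpow_le_rpow_of_nonpos (by positivity) ?_ (by linarith)
        have : M * n + 1 ≤ M * (n + 1) := by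
          have := Nat.pos_of_ne_zero hM
          rw [mul_add]; omega
        exact_mod_cast this

/-- The ring of integers of `K` has three distinct ideals of norm `p`. -/
def HasThreeIdealsOfNorm (K : Type*) [Field K] [NumberField K] (p : ℕ) : Prop :=
  ∃ Q : Fin 3 → Ideal (𝓞 K), Function.Injective Q ∧ ∀ j, Ideal.absNorm (Q j) = p

lemma hasThreeIdealsOfNorm_of_ringHom {K : Type*} [Field K] [NumberField K] {p : ℕ}
    {f : Fin 3 → (𝓞 K →+* ZMod p)} (hf : Function.Injective f) : HasThreeIdealsOfNorm K p :=
  ⟨fun j => RingHom.ker (f j), fun _ _ h => hf (RingHom.eq_of_ker_eq_zmod h), fun j => absNorm_ker (f j)⟩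

lemma exists_ideal_family (K : Type*) [Field K] [NumberField K] :
    ∃ P : ℕ × Fin 3 → Ideal (𝓞 K), Set.InjOn P {t | HasThreeIdealsOfNorm K t.1} ∧
      ∀ t, HasThreeIdealsOfNorm K t.1 → Ideal.absNorm (P t) = t.1 := by
  classical
  have hn : ∀ t : ℕ × Fin 3, ∀ h : HasThreeIdealsOfNorm K t.1,
      Ideal.absNorm (h.choose t.2) = t.1 := fun t h => h.choose_spec.2 t.2
  refine ⟨fun t => if h : HasThreeIdealsOfNorm K t.1 then h.choose t.2 else ⊤, ?_, ?_⟩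
  · rintro ⟨p, i⟩ (hp : HasThreeIdealsOfNorm K p) ⟨q, j⟩ (hq : HasThreeIdealsOfNorm K q) h
    simp only [hp, hq, dif_pos] at h
    obtain rfl : p = q := (hn (p, i) hp).symm.trans ((congrArg _ h).trans (hn (q, j) hq))
    rw [hp.choose_spec.1 h]
  · intro t h
    simp only [h, dif_pos]
    exact hn t h

lemma Multiset.eq_of_prod_map_prime_eq {R T : Type*} [CommRing R] [IsDedekindDomain R]
    {P : T → Ideal R} {m m' : Multiset T} {S : Set T} (hP : Set.InjOn P S)
    (hprime : ∀ t ∈ S, Irreducible (P t)) (hm : ∀ t ∈ m, t ∈ S) (hm' : ∀ t ∈ m', t ∈ S)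
    (h : (m.map P).prod = (m'.map P).prod) : m = m' := by
  have key : ∀ m : Multiset T, (∀ t ∈ m, t ∈ S) →
      UniqueFactorizationMonoid.normalizedFactors (m.map P).prod = m.map P := fun m hm =>
    UniqueFactorizationMonoid.normalizedFactors_prod_of_prime fun I hI => by
      obtain ⟨t, ht, rfl⟩ := Multiset.mem_map.1 hI
      exact (hprime t (hm t ht)).prime
  have hmap : m.map P = m'.map P := by rw [← key m hm, ← key m' hm', h]
  rcases isEmpty_or_nonempty T with hT | hT
  · exact Subsingleton.elim _ _
  have inv : ∀ m : Multiset T, (∀ t ∈ m, t ∈ S) →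
      (m.map P).map (Function.invFunOn P S) = m := fun m hm => by
    rw [Multiset.map_map]
    conv_rhs => rw [← Multiset.map_id m]
    exact Multiset.map_congr rfl fun t ht => hP.leftInvOn_invFunOn (hm t ht)
  rw [← inv m hm, ← inv m' hm', hmap]

lemma exists_idealPair_injOn (K₁ K₂ : Type*) [Field K₁] [NumberField K₁] [Field K₂]
    [NumberField K₂] :
    ∃ Φ : Multiset (ℕ × Fin 3) → Ideal (𝓞 K₁) × Ideal (𝓞 K₂),
      let S : Set (Multiset (ℕ × Fin 3)) := {m | ∀ t ∈ m, t.1.Prime ∧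
        (HasThreeIdealsOfNorm K₁ t.1 ∨ HasThreeIdealsOfNorm K₂ t.1)}
      Set.InjOn Φ S ∧ ∀ m ∈ S,
        Ideal.absNorm (Φ m).1 * Ideal.absNorm (Φ m).2 = (m.map Prod.fst).prod := by
  classical
  obtain ⟨P₁, hinj₁, hn₁⟩ := exists_ideal_family K₁
  obtain ⟨P₂, hinj₂, hn₂⟩ := exists_ideal_family K₂
  let A : ℕ × Fin 3 → Prop := fun t => HasThreeIdealsOfNorm K₁ t.1
  have hirr₁ : ∀ t ∈ {t : ℕ × Fin 3 | t.1.Prime ∧ HasThreeIdealsOfNorm K₁ t.1}, Irreducible (P₁ t) :=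
    fun t ht => Ideal.irreducible_of_irreducible_absNorm (by rw [hn₁ t ht.2]; exact ht.1)
  have hirr₂ : ∀ t ∈ {t : ℕ × Fin 3 | t.1.Prime ∧ HasThreeIdealsOfNorm K₂ t.1}, Irreducible (P₂ t) :=
    fun t ht => Ideal.irreducible_of_irreducible_absNorm (by rw [hn₂ t ht.2]; exact ht.1)
  refine ⟨fun m => (((m.filter A).map P₁).prod, ((m.filter (fun t => ¬ A t)).map P₂).prod), ?_, ?_⟩
  · intro m hm m' hm' h
    have hS₁ : ∀ m : Multiset (ℕ × Fin 3), (∀ t ∈ m, t.1.Prime ∧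
        (HasThreeIdealsOfNorm K₁ t.1 ∨ HasThreeIdealsOfNorm K₂ t.1)) → ∀ t ∈ m.filter A,
        t ∈ {t : ℕ × Fin 3 | t.1.Prime ∧ HasThreeIdealsOfNorm K₁ t.1} := fun m hm t ht => by
      rw [Multiset.mem_filter] at ht
      exact ⟨(hm t ht.1).1, ht.2⟩
    have hS₂ : ∀ m : Multiset (ℕ × Fin 3), (∀ t ∈ m, t.1.Prime ∧
        (HasThreeIdealsOfNorm K₁ t.1 ∨ HasThreeIdealsOfNorm K₂ t.1)) →
        ∀ t ∈ m.filter (fun t => ¬ A t),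
        t ∈ {t : ℕ × Fin 3 | t.1.Prime ∧ HasThreeIdealsOfNorm K₂ t.1} := fun m hm t ht => by
      rw [Multiset.mem_filter] at ht
      exact ⟨(hm t ht.1).1, (hm t ht.1).2.resolve_left ht.2⟩
    have h₁ := Multiset.eq_of_prod_map_prime_eq (hinj₁.mono fun t ht => ht.2) hirr₁
      (hS₁ m hm) (hS₁ m' hm') (congrArg Prod.fst h)
    have h₂ := Multiset.eq_of_prod_map_prime_eq (hinj₂.mono fun t ht => ht.2) hirr₂
      (hS₂ m hm) (hS₂ m' hm') (congrArg Prod.snd h)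
    rw [← Multiset.filter_add_not A m, ← Multiset.filter_add_not A m', h₁, h₂]
  · intro m hm
    simp only [map_multiset_prod, Multiset.map_map]
    conv_rhs => rw [← Multiset.filter_add_not A m, Multiset.map_add, Multiset.prod_add]
    congr 2 <;> refine Multiset.map_congr rfl fun t ht => ?_ <;> rw [Multiset.mem_filter] at ht
    · exact hn₁ t ht.2
    · exact hn₂ t ((hm t ht.1).2.resolve_left ht.2)

/-- The prime factors of the entries of a triple, labelled by the position of the entry. -/
def labelledFactors (n : Fin 3 → ℕ) : Multiset (ℕ × Fin 3) :=
  ∑ j, ((n j).primeFactorsList : Multiset ℕ).map fun p => (p, j)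

lemma prod_map_fst_labelledFactors {n : Fin 3 → ℕ} (hn : ∀ j, n j ≠ 0) :
    ((labelledFactors n).map Prod.fst).prod = ∏ j, n j := by
  simp only [labelledFactors, Fin.sum_univ_three, Fin.prod_univ_three, Multiset.map_add,
    Multiset.prod_add, Multiset.map_map, Function.comp_def, Multiset.map_id', Multiset.prod_coe,
    Nat.prod_primeFactorsList (hn _)]

lemma prod_filter_labelledFactors {n : Fin 3 → ℕ} (hn : ∀ j, n j ≠ 0) (i : Fin 3) :
    (((labelledFactors n).filter fun t => t.2 = i).map Prod.fst).prod = n i := by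
  fin_cases i <;>
  simp [labelledFactors, Fin.sum_univ_three, List.filter_map, Function.comp_def,
    Nat.prod_primeFactorsList (hn _)]

/-- It is impossible that every large prime has three degree-one primes above it in one of two
number fields: as `s → 1⁺`, this would give `ζ(s) ^ 3 = O(ζ_{K₁}(s) ζ_{K₂}(s)) = O((s - 1) ^ (-2))`. -/
lemma false_of_hasThreeIdealsOfNorm (K₁ K₂ : Type*) [Field K₁] [NumberField K₁] [Field K₂]
    [NumberField K₂] {M : ℕ} (hM : M ≠ 0)
    (h : ∀ p : ℕ, p.Prime → ¬ p ∣ M → HasThreeIdealsOfNorm K₁ p ∨ HasThreeIdealsOfNorm K₂ p) :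
    False := by
  obtain ⟨Φ, hinj, hnorm⟩ := exists_idealPair_injOn K₁ K₂
  let n : (ℕ × ℕ × ℕ) → Fin 3 → ℕ := fun a => ![M * a.1 + 1, M * a.2.1 + 1, M * a.2.2 + 1]
  have hn0 : ∀ a j, n a j ≠ 0 := by intro a j; fin_cases j <;> simp [n]
  have hn : ∀ a j p, p ∣ n a j → p ∣ M → p ∣ 1 := by
    intro a j p h1 h2
    fin_cases j <;> exact (Nat.dvd_add_right (h2.mul_right _)).1 h1
  have hmem : ∀ a, labelledFactors (n a) ∈ {m : Multiset (ℕ × Fin 3) | ∀ t ∈ m, t.1.Prime ∧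
        (HasThreeIdealsOfNorm K₁ t.1 ∨ HasThreeIdealsOfNorm K₂ t.1)} := by
    intro a t ht
    simp only [labelledFactors, Multiset.mem_sum, Multiset.mem_map, Multiset.mem_coe] at ht
    obtain ⟨j, -, p, hp, rfl⟩ := ht
    have hpp := Nat.prime_of_mem_primeFactorsList hp
    exact ⟨hpp, h p hpp fun hpM =>
      hpp.one_lt.ne' (Nat.dvd_one.1 (hn a j p (Nat.dvd_of_mem_primeFactorsList hp) hpM))⟩
  have hinj' : Function.Injective fun a => Φ (labelledFactors (n a)) := by
    intro a b hab
    have hl := hinj (hmem a) (hmem b) hab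
    have hj : ∀ j, n a j = n b j := fun j => by
      rw [← prod_filter_labelledFactors (hn0 a) j, ← prod_filter_labelledFactors (hn0 b) j, hl]
    have h0 := hj 0
    have h1 := hj 1
    have h2 := hj 2
    simp [n, hM] at h0 h1 h2
    exact Prod.ext h0 (Prod.ext h1 h2)
  have hle : ∀ s, (∑' k : ℕ, dirichletWeight s (M * k + 1)) ^ 3 ≤
      (∑' I : Ideal (𝓞 K₁), dirichletWeight s (Ideal.absNorm I)) *
      ∑' I : Ideal (𝓞 K₂), dirichletWeight s (Ideal.absNorm I) := by
    intro s
    let W : Ideal (𝓞 K₁) × Ideal (𝓞 K₂) → ℝ≥0∞ := fun x =>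
      dirichletWeight s (Ideal.absNorm x.1) * dirichletWeight s (Ideal.absNorm x.2)
    calc (∑' k : ℕ, dirichletWeight s (M * k + 1)) ^ 3
        = ∑' a : ℕ × ℕ × ℕ, dirichletWeight s (∏ j, n a j) := by
          simp only [n, Fin.prod_univ_three, dirichletWeight_mul, Matrix.cons_val, ENNReal.tsum_prod',
            ENNReal.tsum_mul_left, ENNReal.tsum_mul_right]
          ring
      _ = ∑' a : ℕ × ℕ × ℕ, W (Φ (labelledFactors (n a))) := by
          refine tsum_congr fun a => ?_
          simp only [W]
          rw [← dirichletWeight_mul, hnorm _ (hmem a), prod_map_fst_labelledFactors (hn0 a)]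
      _ ≤ ∑' x, W x := ENNReal.tsum_comp_le_tsum_of_injective hinj' W
      _ = _ := by
          simp only [W, ENNReal.tsum_prod', ENNReal.tsum_mul_left, ENNReal.tsum_mul_right]
  obtain ⟨C₁, hC₁, h₁⟩ := exists_tsum_dirichletWeight_absNorm_le K₁
  obtain ⟨C₂, hC₂, h₂⟩ := exists_tsum_dirichletWeight_absNorm_le K₂
  obtain ⟨c, hc, h₃⟩ := eventually_le_tsum_dirichletWeight hM
  have hsmall : ∀ᶠ s in 𝓝[>] (1 : ℝ), s < 1 + c ^ 3 / (C₁ * C₂) :=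
    eventually_nhdsWithin_of_eventually_nhds (eventually_lt_nhds (lt_add_of_pos_right _ (by positivity)))
  obtain ⟨s, hs₁, hs₂, hs₃, hs, hlt⟩ :=
    (h₁.and (h₂.and (h₃.and ((eventually_mem_nhdsWithin).and hsmall)))).exists
  have hs0 : 0 < s - 1 := sub_pos.2 hs
  have key := (pow_le_pow_left' hs₃ 3).trans ((hle s).trans (mul_le_mul' hs₁ hs₂))
  rw [← ENNReal.ofReal_pow (by positivity), ← ENNReal.ofReal_mul (by positivity),
    ENNReal.ofReal_le_ofReal_iff (by positivity)] at key
  have h4 : s - 1 < c ^ 3 / (C₁ * C₂) := by linarith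
  rw [lt_div_iff₀ (by positivity)] at h4
  have h5 : (c / (s - 1)) ^ 3 * (s - 1) ^ 3 = c ^ 3 := by field_simp
  have h6 : C₁ / (s - 1) * (C₂ / (s - 1)) * (s - 1) ^ 3 = (s - 1) * (C₁ * C₂) := by field_simp
  have := mul_le_mul_of_nonneg_right key (pow_pos hs0 3).le
  linarith

lemma not_isSquare_neg_one_padic_three [Fact (Nat.Prime 3)] : ¬ IsSquare (-1 : ℚ_[3]) := by
  rintro ⟨x, hx⟩
  have hn : ‖x‖ ≤ 1 := by
    have := congrArg norm hx
    rw [norm_neg, norm_one, norm_mul] at this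
    nlinarith [norm_nonneg x]
  obtain ⟨z, rfl⟩ : ∃ z : ℤ_[3], (z : ℚ_[3]) = x := ⟨⟨x, hn⟩, rfl⟩
  have h : (-1 : ℤ_[3]) = z * z := Subtype.ext (by push_cast; exact hx)
  have h2 := congrArg (PadicInt.toZMod (p := 3)) h
  rw [map_neg, map_one, map_mul] at h2
  generalize PadicInt.toZMod (p := 3) _ = y at h2
  clear h hx hn z
  revert y
  decide +revert

/-- A rational number that is a square in every `ℚ_[p]` is a square. -/
lemma Rat.isSquare_of_forall_padic {q : ℚ} (h : ∀ (p : ℕ) [Fact p.Prime], IsSquare (q : ℚ_[p])) :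
    IsSquare q := by
  rcases eq_or_ne q 0 with rfl | hq
  · exact IsSquare.zero
  obtain ⟨a, b, hab, ha⟩ := Nat.sq_mul_squarefree (q.num * q.den).natAbs
  have hN : q * (q.den : ℚ) ^ 2 = ((q.num * q.den : ℤ) : ℚ) := by
    push_cast
    nth_rewrite 1 [← Rat.num_div_den q]
    field_simp
  obtain ⟨ε, hε, hNε⟩ : ∃ ε : ℚ, (ε = 1 ∨ ε = -1) ∧ q * (q.den : ℚ) ^ 2 = b ^ 2 * (ε * a) := by
    rw [hN]
    rcases Int.natAbs_eq (q.num * q.den) with h | h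
    · exact ⟨1, .inl rfl, by rw [h, ← hab]; push_cast; ring⟩
    · exact ⟨-1, .inr rfl, by rw [h, ← hab]; push_cast; ring⟩
  have hd : (q.den : ℚ) ≠ 0 := by exact_mod_cast q.den_nz
  have hb : (b : ℚ) ≠ 0 := by
    rintro hb
    rw [hb] at hNε
    simp [hq] at hNε
  have hεa : ε * a = q * (q.den / b) ^ 2 := by
    field_simp; linear_combination -hNε
  have hsq : ∀ (p : ℕ) [Fact p.Prime], IsSquare ((ε * a : ℚ) : ℚ_[p]) := by
    intro p _
    rw [hεa]
    push_cast
    exact (h p).mul (IsSquare.sq _)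
  have ha1 : a = 1 := by
    by_contra ha1
    obtain ⟨p, hp, hpa⟩ := Nat.exists_prime_and_dvd ha1
    have : Fact p.Prime := ⟨hp⟩
    obtain ⟨y, hy⟩ := hsq p
    have hav : padicValNat p a = 1 := by
      refine le_antisymm ?_ (one_le_padicValNat_of_dvd ha.ne_zero hpa)
      by_contra hlt
      exact hp.one_lt.ne' (Nat.isUnit_iff.1 (ha p (by
        rw [← sq]; exact (padicValNat_dvd_iff_le ha.ne_zero).2 (by omega))))
    have hy0 : y ≠ 0 := by
      rintro rfl
      rcases hε with rfl | rfl <;> simp [ha.ne_zero] at hy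
    have := congrArg Padic.valuation hy
    rw [Padic.valuation_mul hy0 hy0] at this
    have h2 : Padic.valuation ((ε * a : ℚ) : ℚ_[p]) = 1 := by
      rw [Padic.valuation_ratCast]
      rcases hε with rfl | rfl <;> simp [hav]
    omega
  subst ha1
  rcases hε with rfl | rfl
  · refine ⟨b / q.den, ?_⟩
    field_simp
    linear_combination hNε
  · have : Fact (Nat.Prime 3) := ⟨Nat.prime_three⟩
    exact absurd (by simpa using hsq 3) not_isSquare_neg_one_padic_three

/-- A three-cycle of `x ^ 2 + c` consists of roots of a cubic determined by its trace. -/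
lemma cubic_of_cycle {F : Type*} [Field F] [CharZero F] {c x y z : F}
    (hy : y = x ^ 2 + c) (hz : z = y ^ 2 + c) (hx : x = z ^ 2 + c)
    (hxy : y ≠ x) :
    (x + y + z) ^ 2 + (x + y + z) + c + 2 = 0 ∧
    x ^ 3 - (x + y + z) * x ^ 2 - ((x + y + z) ^ 2 + 2 * (x + y + z) + 3) * x + (x + y + z) ^ 3
      + 2 * (x + y + z) ^ 2 + 3 * (x + y + z) + 1 = 0 := by
  have h1 : (x + y) * (x - y) = y - z := by linear_combination -hy + hz
  have h2 : (y + z) * (y - z) = z - x := by linear_combination -hz + hx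
  have h3 : (z + x) * (z - x) = x - y := by linear_combination -hx + hy
  have hd : x - y ≠ 0 := sub_ne_zero.2 hxy.symm
  have hd2 : y - z ≠ 0 := by
    intro h; rw [h, mul_zero] at h2; rw [← h2, mul_zero] at h3; exact hd h3.symm
  have hd3 : z - x ≠ 0 := by
    intro h; rw [h, mul_zero] at h3; exact hd h3.symm
  have hP : (x + y) * (y + z) * (z + x) = 1 := by
    apply mul_right_cancel₀ hd
    linear_combination (y + z) * (z + x) * h1 + (z + x) * h2 + h3
  have k1 : 1 + (x + y) + (x + y) * (y + z) = 0 := by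
    apply mul_right_cancel₀ hd
    linear_combination (1 + (y + z)) * h1 + h2
  have k2 : 1 + (y + z) + (y + z) * (z + x) = 0 := by
    apply mul_right_cancel₀ hd2
    linear_combination (1 + (z + x)) * h2 + h3
  have k3 : 1 + (z + x) + (z + x) * (x + y) = 0 := by
    apply mul_right_cancel₀ hd3
    linear_combination (1 + (x + y)) * h3 + h1
  constructor
  · have : (3 : F) ≠ 0 := by norm_num
    apply mul_left_cancel₀ this
    linear_combination 2 * (k1 + k2 + k3) - hy - hz - hx
  · linear_combination (y + z) * (k1 + k2 + k3) - hP

lemma cycle_of_cubic {F : Type*} [Field F] {t x : F}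
    (h : x ^ 3 - t * x ^ 2 - (t ^ 2 + 2 * t + 3) * x + t ^ 3 + 2 * t ^ 2 + 3 * t + 1 = 0) :
    let c := -(t ^ 2 + t + 2)
    let y := x ^ 2 + c
    let z := y ^ 2 + c
    z ^ 2 + c = x ∧ (x - y) * (y - z) * (z - x) = - (4 * t ^ 2 + 6 * t + 9) := by
  intro c y z
  have hz : z = t - x - y := by
    simp only [z, y, c]; linear_combination (x + t) * h
  rw [hz]
  refine ⟨?_, ?_⟩
  · simp only [y, c]; linear_combination (x + 2 + t) * h
  · simp only [y, c]; grind

lemma cubic_next {F : Type*} [Field F] {t x : F}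
    (h : x ^ 3 - t * x ^ 2 - (t ^ 2 + 2 * t + 3) * x + t ^ 3 + 2 * t ^ 2 + 3 * t + 1 = 0) :
    let y := x ^ 2 + -(t ^ 2 + t + 2)
    y ^ 3 - t * y ^ 2 - (t ^ 2 + 2 * t + 3) * y + t ^ 3 + 2 * t ^ 2 + 3 * t + 1 = 0 := by
  intro y
  simp only [y]
  grind

/-- The cubic whose roots form a three-cycle of trace `t` of `x ^ 2 - (t ^ 2 + t + 2)`. -/
noncomputable def cycleCubic (t : ℚ) : ℚ[X] :=
  X ^ 3 - C t * X ^ 2 - C (t ^ 2 + 2 * t + 3) * X + C (t ^ 3 + 2 * t ^ 2 + 3 * t + 1)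

lemma eval₂_cycleCubic {F : Type*} [Field F] [CharZero F] (i : ℚ →+* F) (t : ℚ) (x : F) :
    eval₂ i x (cycleCubic t) =
      x ^ 3 - t * x ^ 2 - (t ^ 2 + 2 * t + 3) * x + t ^ 3 + 2 * t ^ 2 + 3 * t + 1 := by
  simp only [cycleCubic, eval₂_add, eval₂_sub, eval₂_mul, eval₂_pow, eval₂_X, eval₂_C]
  simp only [eq_ratCast]
  push_cast
  ring

lemma natDegree_cycleCubic (t : ℚ) : (cycleCubic t).natDegree = 3 := by
  unfold cycleCubic; compute_degree!

lemma isIntegral_den_mul_root {F : Type*} [Field F] [CharZero F] {i : ℚ →+* F} {t : ℚ}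
    {x : F} (hx : eval₂ i x (cycleCubic t) = 0) : IsIntegral ℤ ((t.den : F) * x) := by
  rw [eval₂_cycleCubic] at hx
  refine ⟨X ^ 3 - C t.num * X ^ 2 - C (t.num ^ 2 + 2 * t.num * t.den + 3 * t.den ^ 2) * X +
    C (t.num ^ 3 + 2 * t.num ^ 2 * t.den + 3 * t.num * t.den ^ 2 + t.den ^ 3), by monicity!, ?_⟩
  have ht : (t : F) * t.den = t.num := by exact_mod_cast Rat.mul_den_eq_num t
  simp only [eval₂_add, eval₂_sub, eval₂_mul, eval₂_pow, eval₂_X, eval₂_C]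
  simp only [eq_intCast]
  push_cast
  rw [← ht]
  linear_combination (t.den : F) ^ 3 * hx

lemma exists_numberField_of_irreducible_cycleCubic {t : ℚ} (ht : Irreducible (cycleCubic t)) :
    ∃ (K : Type) (_ : Field K) (_ : NumberField K) (M : ℕ), M ≠ 0 ∧
      ∀ (p : ℕ) [Fact p.Prime], ¬ p ∣ M →
        (∃ x : ℚ_[p], eval₂ (algebraMap ℚ ℚ_[p]) x (cycleCubic t) = 0) →
        HasThreeIdealsOfNorm K p := by
  have : Fact (Irreducible (cycleCubic t)) := ⟨ht⟩
  let K := AdjoinRoot (cycleCubic t)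
  have : FiniteDimensional ℚ K := (AdjoinRoot.powerBasis ht.ne_zero).finite
  have : CharZero K := algebraRat.charZero K
  have hK : NumberField K := ⟨⟩
  refine ⟨K, inferInstance, hK, (t.den * (4 * t.num ^ 2 + 6 * t.num * t.den + 9 * t.den ^ 2)).natAbs,
    ?_, ?_⟩
  · have hD : (t.den : ℤ) ≠ 0 := by exact_mod_cast t.den_nz
    rw [Int.natAbs_ne_zero]
    refine mul_ne_zero hD (ne_of_gt ?_)
    have : 0 < (t.den : ℤ) ^ 2 := by positivity
    nlinarith [sq_nonneg (2 * t.num + 2 * t.den : ℤ), sq_nonneg (2 * t.num + t.den : ℤ)]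
  · rintro p _ hpM ⟨x, hx⟩
    let θ : 𝓞 K := ⟨(t.den : K) * AdjoinRoot.root (cycleCubic t),
      isIntegral_den_mul_root (AdjoinRoot.eval₂_root (cycleCubic t))⟩
    let y := x ^ 2 + -((t : ℚ_[p]) ^ 2 + t + 2)
    let z := y ^ 2 + -((t : ℚ_[p]) ^ 2 + t + 2)
    rw [eval₂_cycleCubic] at hx
    have hy := cubic_next hx
    have hz := cubic_next hy
    obtain ⟨-, hδ⟩ := cycle_of_cubic hx
    have hroots : ∀ j, eval₂ (algebraMap ℚ ℚ_[p]) ((![x, y, z] : Fin 3 → ℚ_[p]) j) (cycleCubic t) = 0 := by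
      intro j
      rw [eval₂_cycleCubic]
      fin_cases j
      exacts [hx, hy, hz]
    have hψ : ∀ j, ∃ ψ : 𝓞 K →+* ℤ_[p], (ψ θ : ℚ_[p]) = t.den * (![x, y, z] : Fin 3 → ℚ_[p]) j := by
      intro j
      obtain ⟨ψ, hψ⟩ := exists_ringHom_padicInt
        (AdjoinRoot.lift (algebraMap ℚ ℚ_[p]) _ (hroots j))
      refine ⟨ψ, ?_⟩
      rw [hψ]
      change AdjoinRoot.lift (algebraMap ℚ ℚ_[p]) _ (hroots j)
        ((t.den : K) * AdjoinRoot.root (cycleCubic t)) = _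
      rw [map_mul, map_natCast, AdjoinRoot.lift_root]
    choose ψ hψ using hψ
    refine hasThreeIdealsOfNorm_of_ringHom (f := fun j => (PadicInt.toZMod).comp (ψ j)) ?_
    have hprod : (ψ 0 θ - ψ 1 θ) * (ψ 1 θ - ψ 2 θ) * (ψ 2 θ - ψ 0 θ) =
        ((-(t.den * (4 * t.num ^ 2 + 6 * t.num * t.den + 9 * t.den ^ 2)) : ℤ) : ℤ_[p]) := by
      apply Subtype.ext
      have hD : (t : ℚ_[p]) * t.den = t.num := by exact_mod_cast Rat.mul_den_eq_num t
      rw [PadicInt.coe_intCast]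
      push_cast
      rw [hψ, hψ, hψ, ← hD]
      simp only [Matrix.cons_val]
      linear_combination (t.den : ℚ_[p]) ^ 3 * hδ
    intro i j hij
    by_contra hne
    have hθ : PadicInt.toZMod (ψ i θ) = PadicInt.toZMod (ψ j θ) := DFunLike.congr_fun hij θ
    have h0 := congrArg PadicInt.toZMod hprod
    simp only [map_mul, map_sub, map_intCast] at h0
    have h1 : (PadicInt.toZMod (ψ 0 θ) - PadicInt.toZMod (ψ 1 θ)) *
        (PadicInt.toZMod (ψ 1 θ) - PadicInt.toZMod (ψ 2 θ)) *
        (PadicInt.toZMod (ψ 2 θ) - PadicInt.toZMod (ψ 0 θ)) = 0 := by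
      fin_cases i <;> fin_cases j <;> first | exact absurd rfl hne | simp_all
    rw [h1, eq_comm, ZMod.intCast_zmod_eq_zero_iff_dvd] at h0
    rw [dvd_neg] at h0
    exact hpM (Int.natCast_dvd.1 h0)

/-- The map `f` has a point of exact period `n`. -/
def HasPointOfPeriod {F : Type*} (f : F → F) (n : ℕ) : Prop :=
  ∃ α : F, f^[n] α = α ∧ ∀ i : ℕ, 1 ≤ i → i < n → f^[i] α ≠ α

lemma HasPointOfPeriod.congr {F G : Type*} {f : F → F} {g : G → G} (h : F ≃ G)
    (hfg : Function.Semiconj h f g) (n : ℕ) : HasPointOfPeriod f n ↔ HasPointOfPeriod g n := by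
  have key : ∀ i α, g^[i] (h α) = h α ↔ f^[i] α = α := fun i α => by
    rw [← (hfg.iterate_right i).eq, h.injective.eq_iff]
  refine ⟨fun ⟨α, h₁, h₂⟩ => ⟨h α, (key _ _).2 h₁, fun i hi hin => (key _ _).not.2 (h₂ i hi hin)⟩,
    fun ⟨α, h₁, h₂⟩ => ⟨h.symm α, ?_⟩⟩
  obtain ⟨β, rfl⟩ := h.surjective α
  rw [h.symm_apply_apply]
  exact ⟨(key _ _).1 h₁, fun i hi hin => (key _ _).not.1 (h₂ i hi hin)⟩

lemma hasPointOfPeriod_quadratic_iff {F : Type*} [Field F] [CharZero F] {a : F}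
    (ha : a ≠ 0) (b c : F) (n : ℕ) : HasPointOfPeriod (fun x : F => a * x ^ 2 + b * x + c) n ↔
      HasPointOfPeriod (fun x : F => x ^ 2 + (a * c - b ^ 2 / 4 + b / 2)) n :=
  HasPointOfPeriod.congr ((Equiv.mulLeft₀ a ha).trans (Equiv.addRight (b / 2)))
    (fun x => by simp; ring) n

lemma hasPointOfPeriod_one_iff {F : Type*} (f : F → F) : HasPointOfPeriod f 1 ↔ ∃ x, f x = x :=
  exists_congr fun x => ⟨fun h => h.1, fun h => ⟨h, fun i hi hin => by omega⟩⟩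

lemma hasPointOfPeriod_two_iff {F : Type*} (f : F → F) :
    HasPointOfPeriod f 2 ↔ ∃ x, f (f x) = x ∧ f x ≠ x :=
  exists_congr fun x => and_congr_right fun _ =>
    ⟨fun h => h 1 le_rfl one_lt_two, fun h i hi hin => by
      obtain rfl : i = 1 := by omega
      exact h⟩

lemma hasPointOfPeriod_three_iff {F : Type*} (f : F → F) :
    HasPointOfPeriod f 3 ↔ ∃ x, f (f (f x)) = x ∧ f x ≠ x :=
  exists_congr fun x => and_congr_right fun h3 =>
    ⟨fun h => h 1 le_rfl (by norm_num), fun h i hi hin => by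
      obtain rfl | rfl : i = 1 ∨ i = 2 := by omega
      · exact h
      · intro h2
        have h2 : f (f x) = x := h2
        have h3 : f (f (f x)) = x := h3
        rw [h2] at h3
        exact h h3⟩

lemma hasPointOfPeriod_one_of_padic {c : ℚ}
    (h : ∀ (p : ℕ) [Fact p.Prime], HasPointOfPeriod (fun x : ℚ_[p] => x ^ 2 + (c : ℚ_[p])) 1) :
    HasPointOfPeriod (fun x : ℚ => x ^ 2 + c) 1 := by
  simp only [hasPointOfPeriod_one_iff] at h ⊢
  obtain ⟨r, hr⟩ : IsSquare (1 - 4 * c) := Rat.isSquare_of_forall_padic fun p _ => by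
    obtain ⟨x, hx⟩ := h p
    exact ⟨2 * x - 1, by push_cast; linear_combination -4 * hx⟩
  exact ⟨(r + 1) / 2, by linear_combination -hr / 4⟩

lemma hasPointOfPeriod_two_of_padic {c : ℚ}
    (h : ∀ (p : ℕ) [Fact p.Prime], HasPointOfPeriod (fun x : ℚ_[p] => x ^ 2 + (c : ℚ_[p])) 2) :
    HasPointOfPeriod (fun x : ℚ => x ^ 2 + c) 2 := by
  simp only [hasPointOfPeriod_two_iff] at h ⊢
  have key : ∀ (p : ℕ) [Fact p.Prime], ∃ x : ℚ_[p], 2 * x + 1 ≠ 0 ∧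
      ((-3 - 4 * c : ℚ) : ℚ_[p]) = (2 * x + 1) * (2 * x + 1) := fun p _ => by
    obtain ⟨x, hx, hne⟩ := h p
    have hs : x + (x ^ 2 + c) + 1 = 0 := by
      apply mul_right_cancel₀ (sub_ne_zero.2 hne)
      linear_combination hx
    refine ⟨x, fun h0 => hne ?_, by push_cast; linear_combination -4 * hs⟩
    linear_combination hs - h0
  obtain ⟨r, hr⟩ : IsSquare (-3 - 4 * c) := Rat.isSquare_of_forall_padic fun p _ => by
    obtain ⟨x, -, hx⟩ := key p
    exact ⟨_, hx⟩
  have hr0 : r ≠ 0 := by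
    rintro rfl
    have : Fact (Nat.Prime 2) := ⟨Nat.prime_two⟩
    obtain ⟨x, hx0, hx⟩ := key 2
    rw [hr] at hx
    simp [hx0] at hx
  have hy : ((r - 1) / 2) ^ 2 + c = -1 - (r - 1) / 2 := by linear_combination -hr / 4
  refine ⟨(r - 1) / 2, ?_, ?_⟩
  · simp only [hy]; linear_combination -hr / 4
  · simp only [hy]
    intro h0
    exact hr0 (by linear_combination -h0)

lemma hasPointOfPeriod_three_of_root {c t x : ℚ} (hc : c = -(t ^ 2 + t + 2))
    (hx : (cycleCubic t).IsRoot x) : HasPointOfPeriod (fun x : ℚ => x ^ 2 + c) 3 := by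
  subst hc
  rw [IsRoot, ← eval₂_id, eval₂_cycleCubic] at hx
  obtain ⟨h3, hδ⟩ := cycle_of_cubic hx
  rw [hasPointOfPeriod_three_iff]
  refine ⟨x, h3, fun h1 => ?_⟩
  simp only [Rat.cast_id] at h1 hδ
  rw [h1] at hδ
  nlinarith [sq_nonneg (2 * t + 3 / 2)]

lemma hasPointOfPeriod_three_of_padic {c : ℚ}
    (h : ∀ (p : ℕ) [Fact p.Prime], HasPointOfPeriod (fun x : ℚ_[p] => x ^ 2 + (c : ℚ_[p])) 3) :
    HasPointOfPeriod (fun x : ℚ => x ^ 2 + c) 3 := by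
  have key : ∀ (p : ℕ) [Fact p.Prime], ∃ τ x : ℚ_[p], τ ^ 2 + τ + c + 2 = 0 ∧
      x ^ 3 - τ * x ^ 2 - (τ ^ 2 + 2 * τ + 3) * x + τ ^ 3 + 2 * τ ^ 2 + 3 * τ + 1 = 0 := fun p _ => by
    obtain ⟨x, h3, h1⟩ := (hasPointOfPeriod_three_iff _).1 (h p)
    exact ⟨_, x, cubic_of_cycle rfl rfl h3.symm h1⟩
  obtain ⟨s, hs⟩ : IsSquare (-7 - 4 * c) := Rat.isSquare_of_forall_padic fun p _ => by
    obtain ⟨τ, x, hτ, -⟩ := key p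
    exact ⟨2 * τ + 1, by push_cast; linear_combination -4 * hτ⟩
  have hirr : ∀ t : ℚ, c = -(t ^ 2 + t + 2) →
      ¬ HasPointOfPeriod (fun x : ℚ => x ^ 2 + c) 3 → Irreducible (cycleCubic t) := fun t ht hno =>
    irreducible_of_degree_le_three_of_not_isRoot (by simp [natDegree_cycleCubic]) fun x hx =>
      hno (hasPointOfPeriod_three_of_root ht hx)
  by_contra hno
  obtain ⟨K₁, _, _, M₁, hM₁, h₁⟩ := exists_numberField_of_irreducible_cycleCubic
    (hirr ((s - 1) / 2) (by linear_combination -hs / 4) hno)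
  obtain ⟨K₂, _, _, M₂, hM₂, h₂⟩ := exists_numberField_of_irreducible_cycleCubic
    (hirr ((-s - 1) / 2) (by linear_combination -hs / 4) hno)
  refine false_of_hasThreeIdealsOfNorm K₁ K₂ (mul_ne_zero hM₁ hM₂) fun p hp hpM => ?_
  have : Fact p.Prime := ⟨hp⟩
  obtain ⟨τ, x, hτ, hx⟩ := key p
  have hs' : ((-7 - 4 * c : ℚ) : ℚ_[p]) = ((s * s : ℚ) : ℚ_[p]) := congrArg _ hs
  push_cast at hs'
  have hfac : (2 * τ + 1 - s) * (2 * τ + 1 + s) = 0 := by linear_combination 4 * hτ + hs'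
  rcases mul_eq_zero.1 hfac with h0 | h0
  · have hτs : τ = (((s - 1) / 2 : ℚ) : ℚ_[p]) := by push_cast; linear_combination h0 / 2
    refine .inl (h₁ p (fun hd => hpM (hd.mul_right _)) ⟨x, ?_⟩)
    rw [eval₂_cycleCubic, ← hτs, hx]
  · have hτs : τ = (((-s - 1) / 2 : ℚ) : ℚ_[p]) := by push_cast; linear_combination h0 / 2
    refine .inr (h₂ p (fun hd => hpM (hd.mul_left _)) ⟨x, ?_⟩)
    rw [eval₂_cycleCubic, ← hτs, hx]

/-- Krumm: let f(x) = ax² + bx + c with a, b, c ∈ ℚ, a ≠ 0, and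
n ∈ {1, 2, 3}. If for every prime p the polynomial f has a ℚ_p-rational periodic point of
exact period n, then f has a ℚ-rational periodic point of exact period n. -/
theorem krumm_local_global (a b c : ℚ) (ha : a ≠ 0) (n : ℕ) (hn : n ∈ ({1, 2, 3} : Set ℕ))
    (hlocal : ∀ (p : ℕ) [Fact p.Prime], ∃ α : ℚ_[p],
      (fun x : ℚ_[p] => (a : ℚ_[p]) * x ^ 2 + (b : ℚ_[p]) * x + (c : ℚ_[p]))^[n] α = α ∧
      ∀ i : ℕ, 1 ≤ i → i < n →
        (fun x : ℚ_[p] => (a : ℚ_[p]) * x ^ 2 + (b : ℚ_[p]) * x + (c : ℚ_[p]))^[i] α ≠ α) :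
    ∃ α : ℚ, (fun x : ℚ => a * x ^ 2 + b * x + c)^[n] α = α ∧
      ∀ i : ℕ, 1 ≤ i → i < n → (fun x : ℚ => a * x ^ 2 + b * x + c)^[i] α ≠ α := by
  have hred : ∀ (p : ℕ) [Fact p.Prime], HasPointOfPeriod
      (fun x : ℚ_[p] => x ^ 2 + ((a * c - b ^ 2 / 4 + b / 2 : ℚ) : ℚ_[p])) n := fun p _ => by
    push_cast
    exact (hasPointOfPeriod_quadratic_iff (by exact_mod_cast ha) _ _ n).1 (hlocal p)
  refine (hasPointOfPeriod_quadratic_iff ha b c n).2 ?_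
  rcases hn with rfl | rfl | rfl
  · exact hasPointOfPeriod_one_of_padic hred
  · exact hasPointOfPeriod_two_of_padic hred
  · exact hasPointOfPeriod_three_of_padic hred
end

section
/- Let f(x) = a·x² + b with a, b ∈ ℤ positive integers. There is a constant C, depending only on a and b, such that for every α ∈ ℤ and every odd prime p, the forward orbit of the residue of α under the induced map f̃ : ℤ/pℤ → ℤ/pℤ satisfies #{f̃^n(α mod p) : n ≥ 0} ≤ C · p / log log p. -/
/-- A filtered `k`-algebra of generic rank `2 ^ m` over a polynomial ring in one variable `y`,
obtained by adjoining `m` square roots, with a derivation that is nonzero on `y`. -/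
structure QuadraticTower (k R : Type) [Field k] [CommRing R] [Algebra k R] where
  F : ℕ → Submodule k R
  D : Derivation k R R
  y : R
  m : ℕ
  mono : Monotone F
  one_mem : 1 ∈ F 0
  mul_mem : ∀ {d e : ℕ} {x z : R}, x ∈ F d → z ∈ F e → x * z ∈ F (d + e)
  exhaust : ∀ x : R, ∃ d, x ∈ F d
  finite : ∀ d, FiniteDimensional k (F d)
  finrank_le : ∀ d, Module.finrank k (F d) ≤ 2 ^ m * (d + 1)
  le_finrank : ∀ d, 2 ^ m * (d + 1) ≤ Module.finrank k (F d) + 2 ^ m * m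
  D_mem : ∀ {d : ℕ} {x : R}, x ∈ F d → D x ∈ F (d + m)
  dvd_of_sq : ∃ e : ℕ, ∀ x s r : R, s ≠ 0 → x ^ 2 = s ^ 2 * r → s ∣ D y ^ e * x

section VanishingOrder

variable {k R : Type} [Field k] [CommRing R] [Algebra k R]

/-- The derivatives of `x` of order less than `s` vanish at the point `P`. -/
def VanishesToOrder (D : Derivation k R R) (P : R →ₐ[k] k) (s : ℕ) (x : R) : Prop :=
  ∀ i < s, P (D^[i] x) = 0

variable {D : Derivation k R R} {P : R →ₐ[k] k}

theorem vanishesToOrder_succ {s : ℕ} {x : R} :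
    VanishesToOrder D P (s + 1) x ↔ P x = 0 ∧ VanishesToOrder D P s (D x) := by
  constructor
  · intro h
    exact ⟨h 0 (Nat.succ_pos s), fun i hi => h (i + 1) (Nat.succ_lt_succ hi)⟩
  · rintro ⟨h0, h1⟩ i hi
    cases i with
    | zero => exact h0
    | succ i => exact h1 i (Nat.lt_of_succ_lt_succ hi)

theorem VanishesToOrder.of_succ {s : ℕ} {x : R} (h : VanishesToOrder D P (s + 1) x) :
    VanishesToOrder D P s x := fun i hi => h i (Nat.lt_succ_of_lt hi)

theorem VanishesToOrder.add {s : ℕ} {x z : R} (hx : VanishesToOrder D P s x)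
    (hz : VanishesToOrder D P s z) : VanishesToOrder D P s (x + z) := by
  intro i hi
  rw [iterate_map_add, map_add, hx i hi, hz i hi, add_zero]

theorem VanishesToOrder.mul_right {s : ℕ} {x : R} (hx : VanishesToOrder D P s x) (z : R) :
    VanishesToOrder D P s (x * z) := by
  induction s generalizing x z with
  | zero => intro i hi; omega
  | succ s ih =>
    have h := vanishesToOrder_succ.1 hx
    refine vanishesToOrder_succ.2 ⟨by rw [map_mul, h.1, zero_mul], ?_⟩
    rw [Derivation.leibniz, smul_eq_mul, smul_eq_mul, mul_comm z]
    exact (ih hx.of_succ _).add (ih h.2 _)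

theorem VanishesToOrder.mul_succ {s : ℕ} {x h : R} (hx : VanishesToOrder D P s x)
    (hh : P h = 0) : VanishesToOrder D P (s + 1) (x * h) := by
  induction s generalizing x with
  | zero =>
    intro i hi
    obtain rfl : i = 0 := by omega
    simp [hh]
  | succ s ih =>
    refine vanishesToOrder_succ.2 ⟨by rw [map_mul, hh, mul_zero], ?_⟩
    rw [Derivation.leibniz, smul_eq_mul, smul_eq_mul, mul_comm h]
    exact (hx.mul_right _).add (ih (vanishesToOrder_succ.1 hx).2)

theorem vanishesToOrder_pow {h : R} (hh : P h = 0) (s : ℕ) : VanishesToOrder D P s (h ^ s) := by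
  induction s with
  | zero => intro i hi; omega
  | succ s ih => rw [pow_succ]; exact ih.mul_succ hh

theorem apply_iterate_pow_mul {t : R} (ht : P t = 0) (j : ℕ) (x : R) :
    P (D^[j] (t ^ j * x)) = j.factorial * P (D t) ^ j * P x := by
  induction j generalizing x with
  | zero => simp
  | succ j ih =>
    have h1 : D (t ^ (j + 1) * x) = t ^ j * (((j + 1 : ℕ) : R) * D t * x) + t ^ (j + 1) * D x := by
      rw [Derivation.leibniz, Derivation.leibniz_pow]
      simp only [smul_eq_mul, nsmul_eq_mul, Nat.add_sub_cancel]
      ring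
    have h2 : P (D^[j] (t ^ (j + 1) * D x)) = 0 :=
      (vanishesToOrder_pow ht (j + 1)).mul_right (D x) j (Nat.lt_succ_self j)
    rw [Function.iterate_succ_apply, h1, iterate_map_add, map_add, h2, ih, add_zero]
    simp only [map_mul, map_natCast, Nat.factorial_succ]
    push_cast
    ring

theorem iterate_derivation_mul_pow_char {p : ℕ} [CharP R p] (x h : R) (i : ℕ) :
    D^[i] (x * h ^ p) = D^[i] x * h ^ p := by
  induction i generalizing x with
  | zero => rfl
  | succ i ih =>
    have : D (x * h ^ p) = D x * h ^ p := by
      rw [Derivation.leibniz, Derivation.leibniz_pow]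
      simp [mul_comm]
    rw [Function.iterate_succ_apply, this, ih, Function.iterate_succ_apply]

theorem iterate_derivation_sum {ι : Type} (S : Finset ι) (g : ι → R) (i : ℕ) :
    D^[i] (∑ j ∈ S, g j) = ∑ j ∈ S, D^[i] (g j) := by
  induction i generalizing g with
  | zero => rfl
  | succ i ih => simp only [Function.iterate_succ_apply, map_sum, ih]

theorem iterate_derivation_smul (c : k) (x : R) (i : ℕ) : D^[i] (c • x) = c • D^[i] x := by
  induction i generalizing x with
  | zero => rfl
  | succ i ih => rw [Function.iterate_succ_apply, Derivation.map_smul, ih,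
      Function.iterate_succ_apply]

/-- Finitely many points can be separated to any order by an element of the algebra. -/
theorem exists_separating (X : Finset (R →ₐ[k] k)) (P : R →ₐ[k] k) (M : ℕ) :
    ∃ x : R, P x = 1 ∧ ∀ P' ∈ X, P' ≠ P → VanishesToOrder D P' M x := by
  classical
  induction X using Finset.induction_on with
  | empty => exact ⟨1, map_one P, by simp⟩
  | insert P₁ X hP₁ ih =>
    obtain ⟨x, hx, hX⟩ := ih
    by_cases h : P₁ = P
    · refine ⟨x, hx, fun P' hP' hne => ?_⟩
      rcases Finset.mem_insert.1 hP' with rfl | hP'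
      · exact absurd h hne
      · exact hX P' hP' hne
    · obtain ⟨z, hz⟩ : ∃ z, P₁ z ≠ P z := by
        by_contra! hcon
        exact h (AlgHom.ext hcon)
      set w : R := algebraMap k R (P z - P₁ z)⁻¹ * (z - algebraMap k R (P₁ z)) with hw
      have hw1 : P w = 1 := by
        simp only [hw, map_mul, map_sub, AlgHom.commutes, Algebra.algebraMap_self, RingHom.id_apply]
        exact inv_mul_cancel₀ (sub_ne_zero.2 (Ne.symm hz))
      have hw0 : P₁ w = 0 := by
        simp [hw]
      refine ⟨w ^ M * x, by simp [hw1, hx], fun P' hP' hne => ?_⟩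
      rcases Finset.mem_insert.1 hP' with rfl | hP'
      · exact (vanishesToOrder_pow hw0 M).mul_right x
      · rw [mul_comm]
        exact (hX P' hP' hne).mul_right _

end VanishingOrder

namespace QuadraticTower

variable {k R : Type} [Field k] [CommRing R] [Algebra k R]

theorem natCast_factorial_ne_zero {p : ℕ} [CharP k p] (hp : p.Prime) {j : ℕ} (hj : j < p) :
    (j.factorial : k) ≠ 0 := by
  rw [Ne, CharP.cast_eq_zero_iff k p, hp.dvd_factorial]
  omega

/-- The Taylor coefficients of order less than `M` at the points of `X`. -/
def jets (D : Derivation k R R) (X : Finset (R →ₐ[k] k)) (M : ℕ) : R →ₗ[k] (X × Fin M → k) :=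
  LinearMap.pi fun j => (j.1.1 : R →ₗ[k] k) ∘ₗ ((D : R →ₗ[k] R) ^ (j.2 : ℕ))

theorem jets_apply (D : Derivation k R R) (X : Finset (R →ₐ[k] k)) (M : ℕ) (x : R)
    (j : X × Fin M) : jets D X M x j = j.1.1 (D^[j.2] x) := by
  simp [jets, Module.End.pow_apply]

theorem range_jets (T : QuadraticTower k R) {p : ℕ} [CharP k p] (hp : p.Prime)
    (X : Finset (R →ₐ[k] k)) (hX : ∀ P ∈ X, P (T.D T.y) ≠ 0) {M : ℕ} (hM : M ≤ p) :
    LinearMap.range (jets T.D X M) = ⊤ := by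
  classical
  by_contra hne
  obtain ⟨φ, hφ, hle⟩ := Submodule.exists_le_ker_of_lt_top _ (lt_top_iff_ne_top.2 hne)
  have hsum : ∀ x, ∑ j : X × Fin M, φ (Pi.single j 1) * j.1.1 (T.D^[j.2] x) = 0 := by
    intro x
    have h1 : φ (jets T.D X M x) = 0 := hle ⟨x, rfl⟩
    rw [← h1]
    conv_rhs => rw [← Finset.univ_sum_single (jets T.D X M x), map_sum]
    refine Finset.sum_congr rfl fun j _ => ?_
    rw [← jets_apply T.D X M x j, mul_comm, ← smul_eq_mul, ← map_smul, ← Pi.single_smul]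
    simp
  have hall : ∀ j, φ (Pi.single j 1) = 0 := by
    rintro ⟨P, i⟩
    induction hn : M - i using Nat.strong_induction_on generalizing i with
    | _ n ih =>
    obtain ⟨x, hx1, hx⟩ := exists_separating (D := T.D) X P.1 M
    set t : R := T.y - algebraMap k R (P.1 T.y) with ht
    have htP : P.1 t = 0 := by simp [ht]
    have htD : T.D t = T.D T.y := by simp [ht]
    have h := hsum (t ^ (i : ℕ) * x)
    rw [Finset.sum_eq_single (P, i)] at h
    · rw [apply_iterate_pow_mul htP, hx1, htD, mul_one] at h
      rcases mul_eq_zero.1 h with h | h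
      · exact h
      · exact absurd h (mul_ne_zero (natCast_factorial_ne_zero hp (i.2.trans_le hM))
          (pow_ne_zero _ (hX _ P.2)))
    · rintro ⟨P', i'⟩ - hne'
      by_cases hPP : P' = P
      · subst hPP
        rcases lt_trichotomy i' i with hlt | heq | hgt
        · rw [(vanishesToOrder_pow htP (i : ℕ)).mul_right x i' hlt, mul_zero]
        · exact absurd (by rw [heq]) hne'
        · rw [ih (M - i') (by have := i'.2; have : (i : ℕ) < i' := hgt; omega) i' rfl, zero_mul]
      · have := (hx P'.1 P'.2 (fun h => hPP (Subtype.ext h))).mul_right (t ^ (i : ℕ)) i' i'.2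
        rw [mul_comm x] at this
        rw [this, mul_zero]
    · simp
  apply hφ
  ext j
  simpa using hall j

theorem exists_map_eq_top (T : QuadraticTower k R) {V : Type} [AddCommGroup V] [Module k V]
    [FiniteDimensional k V] (f : R →ₗ[k] V) (hf : LinearMap.range f = ⊤) (D₀ : ℕ) :
    ∃ N, D₀ ≤ N ∧ (T.F N).map f = ⊤ := by
  obtain ⟨s, hs⟩ := (Module.Finite.fg_top : (⊤ : Submodule k V).FG)
  choose g hg using LinearMap.range_eq_top.1 hf
  choose d hd using T.exhaust
  refine ⟨D₀ + ∑ v ∈ s, d (g v), by omega, ?_⟩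
  rw [eq_top_iff, ← hs, Submodule.span_le]
  intro v hv
  refine ⟨g v, T.mono ?_ (hd (g v)), hg v⟩
  have := Finset.single_le_sum (f := fun v => d (g v)) (fun _ _ => Nat.zero_le _) hv
  omega

/-- A nonzero element of bounded degree has boundedly many zeros, counted with multiplicity. -/
theorem card_mul_le_of_vanishes (T : QuadraticTower k R) [IsDomain R] {p : ℕ} [CharP k p]
    (hp : p.Prime) (X : Finset (R →ₐ[k] k)) (hX : ∀ P ∈ X, P (T.D T.y) ≠ 0) {M : ℕ} (hM : M ≤ p)
    {d : ℕ} {x : R} (hx : x ∈ T.F d) (hx0 : x ≠ 0)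
    (hv : ∀ P ∈ X, VanishesToOrder T.D P M x) :
    X.card * M ≤ 2 ^ T.m * (d + T.m) := by
  classical
  obtain ⟨N, hdN, hN⟩ := T.exists_map_eq_top _ (T.range_jets hp X hX hM) d
  have := T.finite
  set f := jets T.D X M with hf
  have h1 : Module.finrank k (LinearMap.range (f.domRestrict (T.F N))) = X.card * M := by
    rw [LinearMap.range_domRestrict, hN, finrank_top, Module.finrank_fintype_fun_eq_card]
    simp
  have h2 := LinearMap.finrank_range_add_finrank_ker (f.domRestrict (T.F N))
  have h3 : Module.finrank k (T.F (N - d)) ≤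
      Module.finrank k (LinearMap.ker (f.domRestrict (T.F N))) := by
    let μ : T.F (N - d) →ₗ[k] LinearMap.ker (f.domRestrict (T.F N)) :=
      { toFun := fun z => ⟨⟨x * z, by
            have := T.mul_mem hx z.2
            rwa [Nat.add_sub_cancel' hdN] at this⟩, by
            rw [LinearMap.mem_ker, LinearMap.domRestrict_apply]
            ext j
            rw [hf, jets_apply]
            exact (hv _ j.1.2).mul_right _ _ j.2.2⟩
        map_add' := fun a b => by ext; simp [mul_add]
        map_smul' := fun c a => by ext; simp }
    refine LinearMap.finrank_le_finrank_of_injective (f := μ) fun a b hab => ?_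
    have : x * (a : R) = x * b := congrArg (fun z => ((z.1 : T.F N) : R)) hab
    exact Subtype.ext (mul_left_cancel₀ hx0 this)
  have h4 := T.finrank_le N
  have h5 := T.le_finrank (N - d)
  obtain ⟨e, rfl⟩ := Nat.exists_eq_add_of_le hdN
  rw [Nat.add_sub_cancel_left] at h3 h5
  have : 2 ^ T.m * (d + e + 1) + 2 ^ T.m * T.m = 2 ^ T.m * (e + 1) + 2 ^ T.m * (d + T.m) := by ring
  omega

theorem pow_mem (T : QuadraticTower k R) {d : ℕ} {x : R} (hx : x ∈ T.F d) (n : ℕ) :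
    x ^ n ∈ T.F (n * d) := by
  induction n with
  | zero => simpa using T.one_mem
  | succ n ih =>
    rw [pow_succ, Nat.succ_mul]
    exact T.mul_mem ih hx

theorem iterate_mem (T : QuadraticTower k R) {d : ℕ} {x : R} (hx : x ∈ T.F d) (i : ℕ) :
    T.D^[i] x ∈ T.F (d + i * T.m) := by
  induction i with
  | zero => simpa using hx
  | succ i ih =>
    rw [Function.iterate_succ_apply', Nat.succ_mul, ← add_assoc]
    exact T.D_mem ih

end QuadraticTower

namespace QuadraticTower

theorem exists_auxiliary {k R : Type} [Field k] [CommRing R] [Algebra k R]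
    (T : QuadraticTower k R) {A B M : ℕ}
    {ι : Type} [Fintype ι] (h : ι → R) (hB : ∀ j, h j ∈ T.F B)
    (hlt : M * (2 ^ T.m * (A + B + M * T.m + 1)) < Fintype.card ι * Module.finrank k (T.F A)) :
    ∃ ξ : ι → R, (∀ j, ξ j ∈ T.F A) ∧ ξ ≠ 0 ∧ ∀ i < M, ∑ j, T.D^[i] (ξ j) * h j = 0 := by
  have := T.finite
  let f : (ι → T.F A) →ₗ[k] (Fin M → T.F (A + B + M * T.m)) :=
    { toFun := fun ξ i => ⟨∑ j, T.D^[i] (ξ j : R) * h j, Submodule.sum_mem _ fun j _ =>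
        T.mono (by
          have : (i : ℕ) * T.m ≤ M * T.m := Nat.mul_le_mul_right _ i.2.le
          omega) (T.mul_mem (T.iterate_mem (ξ j).2 i) (hB j))⟩
      map_add' := fun a b => by
        ext i
        simp [iterate_map_add, add_mul, Finset.sum_add_distrib]
      map_smul' := fun c a => by
        ext i
        simp [iterate_derivation_smul, Finset.smul_sum] }
  have hlt' : Module.finrank k (Fin M → T.F (A + B + M * T.m)) <
      Module.finrank k (ι → T.F A) := by
    rw [Module.finrank_pi_fintype, Module.finrank_pi_fintype]
    simp only [Finset.sum_const, Finset.card_univ, Fintype.card_fin, smul_eq_mul]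
    exact lt_of_le_of_lt (Nat.mul_le_mul_left _ (T.finrank_le _)) hlt
  obtain ⟨ξ, hξ, hne⟩ := (Submodule.ne_bot_iff _).1 (LinearMap.ker_ne_bot_of_finrank_lt hlt')
  refine ⟨fun j => ξ j, fun j => (ξ j).2, fun h0 => hne ?_, fun i hi => ?_⟩
  · ext j
    exact congrFun h0 j
  · have h1 : f ξ = 0 := hξ
    exact congrArg (fun z : Fin M → T.F (A + B + M * T.m) => (z ⟨i, hi⟩ : R)) h1

variable {p : ℕ} [Fact p.Prime] {R : Type} [CommRing R] [IsDomain R] [Algebra (ZMod p) R]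

theorem apply_iterate_sum_mul_pow {D : Derivation (ZMod p) R R} (P : R →ₐ[ZMod p] ZMod p)
    {ι : Type} [Fintype ι] (ξ h : ι → R) (i : ℕ) :
    P (D^[i] (∑ j, ξ j * h j ^ p)) = P (∑ j, D^[i] (ξ j) * h j) := by
  have : CharP R p := charP_of_injective_algebraMap (algebraMap (ZMod p) R).injective p
  rw [iterate_derivation_sum, map_sum, map_sum]
  refine Finset.sum_congr rfl fun j _ => ?_
  rw [iterate_derivation_mul_pow_char, map_mul, map_mul, map_pow, ZMod.pow_card]

theorem sum_mul_pow_ne_zero (T : QuadraticTower (ZMod p) R) (X : Finset (R →ₐ[ZMod p] ZMod p))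
    (hX : ∀ P ∈ X, P (T.D T.y) ≠ 0) {A B : ℕ} (hA : 2 ^ T.m * (A + T.m) < p)
    (hB : 2 ^ T.m * (B + T.m) < X.card) {ι : Type} [Fintype ι] {h ξ : ι → R}
    (hmem : ∀ j, h j ∈ T.F B) (hli : LinearIndependent (ZMod p) h)
    (hξ : ∀ j, ξ j ∈ T.F A) (hne : ξ ≠ 0) :
    ∑ j, ξ j * h j ^ p ≠ 0 := by
  intro h0
  have hp : p.Prime := Fact.out
  have hP : ∀ P ∈ X, ∑ j, P (h j) • ξ j = 0 := by
    intro P hPX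
    by_contra hc
    have hle := T.card_mul_le_of_vanishes hp {P} (M := p) (by simpa using hX P hPX) le_rfl
      (Submodule.sum_mem _ fun j _ => Submodule.smul_mem _ (P (h j)) (hξ j)) hc (by
        intro P' hP' i _
        obtain rfl := Finset.mem_singleton.1 hP'
        have h1 := apply_iterate_sum_mul_pow (D := T.D) P' ξ h i
        rw [h0, iterate_map_zero, map_zero] at h1
        rw [iterate_derivation_sum, h1, map_sum, map_sum]
        refine Finset.sum_congr rfl fun j _ => ?_
        rw [iterate_derivation_smul, map_smul, map_mul, smul_eq_mul, mul_comm])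
    simp only [Finset.card_singleton, one_mul] at hle
    omega
  obtain ⟨j₀, hj₀⟩ := Function.ne_iff.1 hne
  obtain ⟨φ, hφ⟩ : ∃ φ : Module.Dual (ZMod p) R, φ (ξ j₀) ≠ 0 := by
    by_contra! hc
    exact hj₀ ((Module.forall_dual_apply_eq_zero_iff (ZMod p) _).1 hc)
  have hz : ∑ j, φ (ξ j) • h j ≠ 0 := fun hc =>
    hφ (Fintype.linearIndependent_iff.1 hli _ hc j₀)
  have hle := T.card_mul_le_of_vanishes hp X (M := 1) hX hp.one_lt.le
    (Submodule.sum_mem _ fun j _ => Submodule.smul_mem _ (φ (ξ j)) (hmem j)) hz (by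
      intro P hPX i hi
      obtain rfl : i = 0 := by omega
      have h1 := congrArg φ (hP P hPX)
      rw [map_sum, map_zero] at h1
      rw [Function.iterate_zero, id, map_sum, ← h1]
      refine Finset.sum_congr rfl fun j _ => ?_
      rw [map_smul, map_smul, smul_eq_mul, smul_eq_mul, mul_comm])
  omega

theorem auxiliary_dimension_count {n c m A a b : ℕ} (hn : 1 ≤ n) (hm : m + 1 = c)
    (hA : A = 8 * c + n * c ^ 2 + 1) (ha : n * (A + 1) ≤ a + n * c)
    (hb : n * (8 * c + 1) ≤ b + n * c) :
    n * c * (n * (A + 8 * c + n * c * m + 1)) < b * a := by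
  have h1 : n * c * m + 8 * c + 1 ≤ A := by
    have : n * c * m ≤ n * c * c := Nat.mul_le_mul_left _ (by omega)
    rw [hA]
    linarith [sq c, mul_assoc n c c]
  have h2 : 7 * (n * c) < b := by linarith
  have h3 : n * A ≤ 2 * a := by
    have : n * (8 * c) ≤ n * A := Nat.mul_le_mul_left _ (by omega)
    linarith
  have h5 : 0 < a := by
    have : 0 < n * A := Nat.mul_pos hn (by omega)
    omega
  calc n * c * (n * (A + 8 * c + n * c * m + 1))
      ≤ n * c * (n * (2 * A)) := by
        gcongr
        omega
    _ = n * c * 2 * (n * A) := by ring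
    _ ≤ n * c * 2 * (2 * a) := Nat.mul_le_mul_left _ h3
    _ ≤ 7 * (n * c) * a := by linarith [Nat.zero_le (n * c * a)]
    _ < b * a := Nat.mul_lt_mul_of_pos_right h2 h5

/-- Stepanov's method: the number of unramified rational points is `O(p)` with an absolute
constant, provided that `p` is large in terms of the degree of the tower. -/
theorem card_points_le (T : QuadraticTower (ZMod p) R) (X : Finset (R →ₐ[ZMod p] ZMod p))
    (hX : ∀ P ∈ X, P (T.D T.y) ≠ 0)
    (hp : 2 ^ T.m * (9 * (T.m + 1) + 2 ^ T.m * (T.m + 1) ^ 2 + 1) < p) :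
    X.card ≤ 9 * p := by
  have hpp : p.Prime := Fact.out
  have := T.finite
  obtain ⟨c, hc⟩ : ∃ c, c = T.m + 1 := ⟨_, rfl⟩
  obtain ⟨n, hn⟩ : ∃ n, n = 2 ^ T.m := ⟨_, rfl⟩
  have hn1 : 1 ≤ n := hn ▸ Nat.one_le_two_pow
  rw [← hc, ← hn] at hp
  obtain ⟨A, hA⟩ : ∃ A, A = 8 * c + n * c ^ 2 + 1 := ⟨_, rfl⟩
  have hAp : n * (A + c) < p := by
    rw [hA]
    convert hp using 2
    ring
  by_cases hsmall : X.card ≤ n * (9 * c)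
  · have : n * (9 * c) ≤ n * (A + c) := Nat.mul_le_mul_left _ (by omega)
    omega
  let bas := Module.finBasis (ZMod p) (T.F (8 * c))
  have hdim : ∀ d, n * (d + 1) ≤ Module.finrank (ZMod p) (T.F d) + n * c := fun d =>
    (hn ▸ T.le_finrank d).trans (Nat.add_le_add_left (Nat.mul_le_mul_left _ (by omega)) _)
  obtain ⟨ξ, hξA, hξ0, hξ⟩ := T.exists_auxiliary (A := A) (B := 8 * c) (M := n * c)
    (fun j => (bas j : R)) (fun j => (bas j).2) (by
      rw [Fintype.card_fin, ← hn]
      exact auxiliary_dimension_count hn1 hc.symm hA (hdim A) (hdim (8 * c)))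
  have hli : LinearIndependent (ZMod p) (fun j => (bas j : R)) :=
    bas.linearIndependent.map' (T.F (8 * c)).subtype (Submodule.ker_subtype _)
  have hΦ0 : ∑ j, ξ j * (bas j : R) ^ p ≠ 0 := T.sum_mul_pow_ne_zero X hX (A := A) (B := 8 * c)
    (lt_of_le_of_lt (by rw [← hn]; exact Nat.mul_le_mul_left _ (by omega)) hAp)
    (lt_of_le_of_lt (by rw [← hn]; exact Nat.mul_le_mul_left _ (by omega)) (not_le.1 hsmall))
    (fun j => (bas j).2) hli hξA hξ0
  have hΦF : ∑ j, ξ j * (bas j : R) ^ p ∈ T.F (A + p * (8 * c)) :=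
    Submodule.sum_mem _ fun j _ => T.mul_mem (hξA j) (T.pow_mem (bas j).2 p)
  have hMp : n * c ≤ p := (Nat.mul_le_mul_left n (Nat.le_add_left c A)).trans hAp.le
  have hle := T.card_mul_le_of_vanishes hpp X hX hMp hΦF hΦ0 (by
    intro P _ i hi
    rw [apply_iterate_sum_mul_pow, hξ i hi, map_zero])
  rw [← hn] at hle
  have h1 : X.card * c ≤ A + p * (8 * c) + T.m :=
    Nat.le_of_mul_le_mul_left (by linarith) hn1
  have h2 : A + c ≤ p := (Nat.le_mul_of_pos_left _ hn1).trans hAp.le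
  have h3 : p ≤ p * c := Nat.le_mul_of_pos_right _ (by omega)
  have h4 : X.card * c ≤ 9 * p * c := by linarith [(by omega : T.m ≤ c)]
  exact Nat.le_of_mul_le_mul_right h4 (by omega)

end QuadraticTower

namespace QuadraticAlgebra

variable {k R : Type} [Field k] [CommRing R] [Algebra k R]

/-- The homomorphism extending `Q` and sending the adjoined square root of `g` to `s`. -/
def extendHom {A : Type} [CommRing A] [Algebra k A] {g : R} (Q : R →ₐ[k] A) (s : A)
    (hs : s ^ 2 = Q g) : QuadraticAlgebra R g 0 →ₐ[k] A where
  toFun z := Q z.re + Q z.im * s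
  map_one' := by simp
  map_zero' := by simp
  map_add' a b := by
    simp only [re_add, im_add, map_add]
    ring
  map_mul' a b := by
    simp only [re_mul, im_mul, map_add, map_mul, ← hs, zero_mul, add_zero]
    ring
  commutes' c := by
    have h1 : (algebraMap k (QuadraticAlgebra R g 0) c) =
        algebraMap R (QuadraticAlgebra R g 0) (algebraMap k R c) := rfl
    rw [h1]
    simp

/-- Restriction of a homomorphism to the base ring. -/
def restrictHom {A : Type} [CommRing A] [Algebra k A] {g : R}
    (Q : QuadraticAlgebra R g 0 →ₐ[k] A) : R →ₐ[k] A where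
  toRingHom := (Q : QuadraticAlgebra R g 0 →+* A).comp (algebraMap R _)
  commutes' c := Q.commutes c

section

variable {A : Type} [CommRing A] [Algebra k A] {g : R}

theorem restrictHom_apply (Q : QuadraticAlgebra R g 0 →ₐ[k] A) (x : R) :
    restrictHom Q x = Q (algebraMap R _ x) := rfl

theorem extendHom_algebraMap (Q : R →ₐ[k] A) (s : A) (hs : s ^ 2 = Q g) (x : R) :
    extendHom Q s hs (algebraMap R _ x) = Q x := by
  change Q _ + Q _ * s = _
  simp

theorem restrictHom_extendHom (Q : R →ₐ[k] A) (s : A) (hs : s ^ 2 = Q g) :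
    restrictHom (extendHom Q s hs) = Q := AlgHom.ext fun x => extendHom_algebraMap Q s hs x

theorem extendHom_omega (Q : R →ₐ[k] A) (s : A) (hs : s ^ 2 = Q g) :
    extendHom Q s hs omega = s := by
  change Q _ + Q _ * s = _
  simp

theorem omega_sq : (omega : QuadraticAlgebra R g 0) ^ 2 = algebraMap R _ g := by
  rw [sq, omega_mul_omega_eq_mk]
  rfl

theorem map_omega_sq (Q : QuadraticAlgebra R g 0 →ₐ[k] A) : Q omega ^ 2 = restrictHom Q g := by
  rw [← map_pow, omega_sq, restrictHom_apply]

theorem eq_add_mul_omega (z : QuadraticAlgebra R g 0) :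
    z = algebraMap R _ z.re + algebraMap R _ z.im * omega := by
  ext <;> simp

theorem finite_algHom [Finite (R →ₐ[k] k)] [Finite k] :
    Finite (QuadraticAlgebra R g 0 →ₐ[k] k) := by
  refine Finite.of_injective (fun Q => (restrictHom Q, Q omega)) fun Q₁ Q₂ h => ?_
  obtain ⟨h1, h2⟩ := Prod.ext_iff.1 h
  refine AlgHom.ext fun z => ?_
  rw [eq_add_mul_omega z, map_add, map_add, map_mul, map_mul]
  simp only at h1 h2
  rw [← restrictHom_apply, ← restrictHom_apply, ← restrictHom_apply, h1, h2]
  rfl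

end

theorem isDomain_of_nonsquare [IsDomain R] {g : R} (hg : ∀ x s : R, s ≠ 0 → x ^ 2 ≠ s ^ 2 * g) :
    IsDomain (QuadraticAlgebra R g 0) := by
  have hnorm : ∀ z : QuadraticAlgebra R g 0, z.re ^ 2 - z.im ^ 2 * g = 0 → z = 0 := by
    intro z hz
    have him : z.im = 0 := by
      by_contra hne
      exact hg _ _ hne (sub_eq_zero.1 hz)
    rw [him] at hz
    have hre : z.re = 0 := by simpa using hz
    ext <;> simp [hre, him]
  have : NoZeroDivisors (QuadraticAlgebra R g 0) := by
    refine ⟨fun {x z} h => ?_⟩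
    have h1 := congrArg QuadraticAlgebra.re h
    have h2 := congrArg QuadraticAlgebra.im h
    simp only [re_mul, im_mul, re_zero, im_zero, zero_mul, add_zero] at h1 h2
    have h3 : (x.re ^ 2 - x.im ^ 2 * g) * (z.re ^ 2 - z.im ^ 2 * g) = 0 := by
      linear_combination (x.re * z.re + g * x.im * z.im) * h1 - g * (x.re * z.im + x.im * z.re) * h2
    rcases mul_eq_zero.1 h3 with h | h
    · exact Or.inl (hnorm _ h)
    · exact Or.inr (hnorm _ h)
  exact NoZeroDivisors.to_isDomain _

/-- The multiple by `2 g` of the extension of a derivation to `R[√g]`. -/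
def extendDerivation (D : Derivation k R R) (g : R) :
    Derivation k (QuadraticAlgebra R g 0) (QuadraticAlgebra R g 0) :=
  Derivation.mk'
    { toFun := fun z => ⟨2 * g * D z.re, 2 * g * D z.im + z.im * D g⟩
      map_add' := fun a b => by
        ext <;> simp <;> ring
      map_smul' := fun c a => by
        ext
        · simp only [re_smul, Derivation.map_smul, RingHom.id_apply, mul_smul_comm]
        · simp only [im_smul, Derivation.map_smul, RingHom.id_apply, mul_smul_comm,
            smul_mul_assoc, smul_add] }
    fun a b => by
      ext <;> simp [Derivation.leibniz] <;> ring

theorem extendDerivation_algebraMap (D : Derivation k R R) (g x : R) :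
    extendDerivation D g (algebraMap R _ x) = algebraMap R _ (2 * g * D x) := by
  ext
  · rfl
  · change 2 * g * D 0 + 0 * D g = 0
    simp

theorem extendDerivation_omega (D : Derivation k R R) (g : R) :
    extendDerivation D g omega = algebraMap R _ (D g) * omega := by
  ext
  · change 2 * g * D 0 = _
    simp
  · change 2 * g * D 1 + 1 * D g = _
    simp

theorem dvd_of_dvd_re_im {g v : R} {x : QuadraticAlgebra R g 0} (h1 : v ∣ x.re) (h2 : v ∣ x.im) :
    algebraMap R _ v ∣ x := by
  obtain ⟨a, ha⟩ := h1
  obtain ⟨b, hb⟩ := h2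
  exact ⟨⟨a, b⟩, by ext <;> simp [ha, hb]⟩

theorem dvd_of_sq_of_base [IsDomain R] {g u : R} [IsDomain (QuadraticAlgebra R g 0)] {e : ℕ}
    (he : ∀ x s r : R, s ≠ 0 → x ^ 2 = s ^ 2 * r → s ∣ u ^ e * x)
    (x s r : QuadraticAlgebra R g 0) (hs : s ≠ 0) (hx : x ^ 2 = s ^ 2 * r) :
    s ∣ algebraMap R _ (2 * g * u) ^ (2 * e + 1) * x := by
  set v : R := s.re ^ 2 - s.im ^ 2 * g with hv
  set s' : QuadraticAlgebra R g 0 := ⟨s.re, -s.im⟩ with hs'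
  have hss : s * s' = algebraMap R _ v := by
    ext
    · simp only [re_mul, algebraMap_re, hs', hv]
      ring
    · simp only [im_mul, algebraMap_im, hs', zero_mul, add_zero]
      ring
  have hs'0 : s' ≠ 0 := by
    intro h
    apply hs
    have h3 := congrArg QuadraticAlgebra.re h
    have h4 := congrArg QuadraticAlgebra.im h
    simp only [hs', re_zero, im_zero, neg_eq_zero] at h3 h4
    ext <;> simp [h3, h4]
  have hv0 : v ≠ 0 := by
    intro h
    rw [h, map_zero] at hss
    exact (mul_ne_zero hs hs'0) hss
  set w := x * s' with hw
  have hw2 : w ^ 2 = algebraMap R _ v ^ 2 * r := by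
    rw [hw, mul_pow, hx, ← hss]
    ring
  have hre := congrArg QuadraticAlgebra.re hw2
  have him := congrArg QuadraticAlgebra.im hw2
  rw [← map_pow] at hre him
  simp only [sq w, re_mul, im_mul, algebraMap_re, algebraMap_im, zero_mul, add_zero, mul_zero]
    at hre him
  obtain ⟨q, hq⟩ := he (w.re ^ 2 - g * w.im ^ 2) (v ^ 2) (r.re ^ 2 - g * r.im ^ 2)
    (pow_ne_zero 2 hv0) (by
      linear_combination (w.re ^ 2 + g * w.im ^ 2 + v ^ 2 * r.re) * hre
        - g * (2 * w.re * w.im + v ^ 2 * r.im) * him)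
  have hdre : v ∣ u ^ e * (2 * u ^ e * w.re) :=
    he _ _ (2 * u ^ e * (q + u ^ e * r.re)) hv0 (by
      linear_combination (2 * u ^ e) * hq + 2 * u ^ (2 * e) * hre)
  have hdim : v ∣ u ^ e * (2 * u ^ e * g * w.im) :=
    he _ _ (2 * u ^ e * g * (u ^ e * r.re - q)) hv0 (by
      linear_combination (-2 * u ^ e * g) * hq + 2 * u ^ (2 * e) * g * hre)
  have hdvd : algebraMap R _ v ∣ algebraMap R _ (2 * g * u) ^ (2 * e + 1) * w := by
    rw [← map_pow]
    refine dvd_of_dvd_re_im ?_ ?_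
    · refine (hdre.mul_left (2 ^ (2 * e) * g ^ (2 * e + 1) * u)).trans (dvd_of_eq ?_)
      simp only [re_mul, algebraMap_re, algebraMap_im, mul_zero, zero_mul, add_zero]
      ring
    · refine (hdim.mul_left (2 ^ (2 * e) * g ^ (2 * e) * u)).trans (dvd_of_eq ?_)
      simp only [im_mul, algebraMap_re, algebraMap_im, mul_zero, zero_mul, add_zero]
      ring
  rw [← hss, hw, ← mul_assoc] at hdvd
  exact (mul_dvd_mul_iff_right hs'0).1 hdvd

end QuadraticAlgebra

namespace QuadraticTower

open QuadraticAlgebra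

variable {k R : Type} [Field k] [CommRing R] [Algebra k R]

/-- The filtration of `R[√g]` in which the square root has degree one. -/
def extendF (F : ℕ → Submodule k R) (g : R) : ℕ → Submodule k (QuadraticAlgebra R g 0) := fun d =>
  { carrier := {z | z.re ∈ F d ∧ (d = 0 → z.im = 0) ∧ z.im ∈ F (d - 1)}
    zero_mem' := ⟨zero_mem _, fun _ => rfl, zero_mem _⟩
    add_mem' := fun {a b} ha hb => ⟨add_mem ha.1 hb.1,
      fun h => by rw [im_add, ha.2.1 h, hb.2.1 h, add_zero], add_mem ha.2.2 hb.2.2⟩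
    smul_mem' := fun c a ha => ⟨Submodule.smul_mem _ c ha.1,
      fun h => by rw [im_smul, ha.2.1 h, smul_zero], Submodule.smul_mem _ c ha.2.2⟩ }

theorem mem_extendF_zero {F : ℕ → Submodule k R} {g : R} {z : QuadraticAlgebra R g 0} :
    z ∈ extendF F g 0 ↔ z.re ∈ F 0 ∧ z.im = 0 :=
  ⟨fun h => ⟨h.1, h.2.1 rfl⟩, fun h => ⟨h.1, fun _ => h.2, by rw [h.2]; exact zero_mem _⟩⟩

theorem mem_extendF_succ {F : ℕ → Submodule k R} {g : R} {d : ℕ} {z : QuadraticAlgebra R g 0} :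
    z ∈ extendF F g (d + 1) ↔ z.re ∈ F (d + 1) ∧ z.im ∈ F d :=
  ⟨fun h => ⟨h.1, h.2.2⟩, fun h => ⟨h.1, fun h0 => absurd h0 (Nat.succ_ne_zero d), h.2⟩⟩

/-- The degree zero part of the extended filtration. -/
def extendFZeroEquiv (F : ℕ → Submodule k R) (g : R) : extendF F g 0 ≃ₗ[k] F 0 where
  toFun z := ⟨z.1.re, (mem_extendF_zero.1 z.2).1⟩
  map_add' _ _ := rfl
  map_smul' _ _ := rfl
  invFun x := ⟨⟨x, 0⟩, mem_extendF_zero.2 ⟨x.2, rfl⟩⟩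
  left_inv z := by
    ext
    · rfl
    · exact (mem_extendF_zero.1 z.2).2.symm
  right_inv _ := rfl

/-- The positive degree parts of the extended filtration. -/
def extendFSuccEquiv (F : ℕ → Submodule k R) (g : R) (d : ℕ) :
    extendF F g (d + 1) ≃ₗ[k] F (d + 1) × F d where
  toFun z := (⟨z.1.re, (mem_extendF_succ.1 z.2).1⟩, ⟨z.1.im, (mem_extendF_succ.1 z.2).2⟩)
  map_add' _ _ := rfl
  map_smul' _ _ := rfl
  invFun x := ⟨⟨x.1, x.2⟩, mem_extendF_succ.2 ⟨x.1.2, x.2.2⟩⟩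
  left_inv _ := rfl
  right_inv _ := rfl

/-- Adjoining a square root of an element of degree at most one. -/
def extend (T : QuadraticTower k R) [IsDomain R] {g : R} (hg : g ∈ T.F 1)
    [IsDomain (QuadraticAlgebra R g 0)] : QuadraticTower k (QuadraticAlgebra R g 0) where
  F := extendF T.F g
  D := extendDerivation T.D g
  y := algebraMap R _ T.y
  m := T.m + 1
  mono := by
    intro d e hde z hz
    refine ⟨T.mono hde hz.1, fun h => hz.2.1 (by omega), T.mono (by omega) hz.2.2⟩
  one_mem := mem_extendF_zero.2 ⟨by simpa using T.one_mem, by simp⟩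
  mul_mem := by
    intro d e x z hx hz
    cases d with
    | zero =>
      rw [mem_extendF_zero] at hx
      rw [zero_add]
      refine ⟨?_, fun h => ?_, ?_⟩
      · simpa [hx.2] using T.mul_mem hx.1 hz.1
      · simp [hx.2, hz.2.1 h]
      · simpa [hx.2] using T.mul_mem hx.1 hz.2.2
    | succ d =>
      cases e with
      | zero =>
        rw [mem_extendF_zero] at hz
        rw [mem_extendF_succ] at hx
        refine mem_extendF_succ.2 ⟨?_, ?_⟩
        · simpa [hz.2] using T.mul_mem hx.1 hz.1
        · simpa [hz.2] using T.mul_mem hx.2 hz.1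
      | succ e =>
        rw [mem_extendF_succ] at hx hz
        rw [← add_assoc, mem_extendF_succ]
        simp only [re_mul, im_mul, zero_mul, add_zero]
        refine ⟨add_mem (T.mono (by omega) (T.mul_mem hx.1 hz.1)) ?_,
          add_mem (T.mono (by omega) (T.mul_mem hx.1 hz.2)) ?_⟩
        · exact T.mono (by omega) (T.mul_mem (T.mul_mem hg hx.2) hz.2)
        · exact T.mono (by omega) (T.mul_mem hx.2 hz.1)
  exhaust := by
    intro z
    obtain ⟨d, hd⟩ := T.exhaust z.re
    obtain ⟨e, he⟩ := T.exhaust z.im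
    exact ⟨d + e + 1, mem_extendF_succ.2 ⟨T.mono (by omega) hd, T.mono (by omega) he⟩⟩
  finite := by
    have := T.finite
    intro d
    cases d with
    | zero => exact LinearEquiv.finiteDimensional (extendFZeroEquiv T.F g).symm
    | succ d => exact LinearEquiv.finiteDimensional (extendFSuccEquiv T.F g d).symm
  finrank_le := by
    have := T.finite
    intro d
    cases d with
    | zero =>
      rw [(extendFZeroEquiv T.F g).finrank_eq, pow_succ]
      have := T.finrank_le 0
      omega
    | succ d =>
      rw [(extendFSuccEquiv T.F g d).finrank_eq, Module.finrank_prod, pow_succ]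
      have h1 := T.finrank_le (d + 1)
      have h2 := T.finrank_le d
      nlinarith
  le_finrank := by
    have := T.finite
    intro d
    cases d with
    | zero =>
      rw [(extendFZeroEquiv T.F g).finrank_eq, pow_succ]
      have := T.le_finrank 0
      generalize 2 ^ T.m = n at *
      nlinarith [Nat.zero_le (n * T.m)]
    | succ d =>
      rw [(extendFSuccEquiv T.F g d).finrank_eq, Module.finrank_prod, pow_succ]
      have h1 := T.le_finrank (d + 1)
      have h2 := T.le_finrank d
      generalize 2 ^ T.m = n at *
      nlinarith
  D_mem := by
    have htwo : ∀ {d : ℕ} {a : R}, a ∈ T.F d → 2 * g * T.D a ∈ T.F (d + T.m + 1) := by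
      intro d a ha
      have h3 := T.mul_mem hg (T.D_mem ha)
      rw [mul_assoc, two_mul]
      exact T.mono (by omega) (add_mem h3 h3)
    intro d x hx
    cases d with
    | zero =>
      rw [mem_extendF_zero] at hx
      rw [zero_add, mem_extendF_succ]
      refine ⟨T.mono (by omega) (htwo hx.1), ?_⟩
      change 2 * g * T.D x.im + x.im * T.D g ∈ _
      rw [hx.2]
      simp
    | succ d =>
      rw [mem_extendF_succ] at hx
      rw [← add_assoc, mem_extendF_succ]
      refine ⟨T.mono (by omega) (htwo hx.1), add_mem (T.mono (by omega) (htwo hx.2)) ?_⟩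
      exact T.mono (by omega) (T.mul_mem hx.2 (T.D_mem hg))
  dvd_of_sq := by
    obtain ⟨e, he⟩ := T.dvd_of_sq
    refine ⟨2 * e + 1, fun x s r hs hx => ?_⟩
    rw [extendDerivation_algebraMap]
    exact dvd_of_sq_of_base he x s r hs hx

/-- The polynomial ring as the trivial tower. -/
noncomputable def base (k : Type) [Field k] : QuadraticTower k (Polynomial k) where
  F d := Polynomial.degreeLT k (d + 1)
  D := Polynomial.derivative'
  y := Polynomial.X
  m := 0
  mono d e h := Polynomial.degreeLT_mono (by omega)
  one_mem := by simp [Polynomial.mem_degreeLT]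
  mul_mem := by
    intro d e x z hx hz
    rw [Polynomial.degreeLT_succ_eq_degreeLE, Polynomial.mem_degreeLE] at *
    refine (Polynomial.degree_mul_le x z).trans ?_
    push_cast
    exact add_le_add hx hz
  exhaust x := ⟨x.natDegree, by
    rw [Polynomial.degreeLT_succ_eq_degreeLE, Polynomial.mem_degreeLE]
    exact Polynomial.degree_le_natDegree⟩
  finite d := inferInstance
  finrank_le d := by
    rw [(Polynomial.degreeLTEquiv k (d + 1)).finrank_eq]
    simp
  le_finrank d := by
    rw [(Polynomial.degreeLTEquiv k (d + 1)).finrank_eq]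
    simp
  D_mem := by
    intro d x hx
    rw [Polynomial.mem_degreeLT] at *
    exact (Polynomial.degree_derivative_le).trans_lt hx
  dvd_of_sq := ⟨0, fun x s r hs h => by
    rw [pow_zero, one_mul]
    exact (IsIntegrallyClosed.pow_dvd_pow_iff two_ne_zero).1 ⟨r, h⟩⟩

end QuadraticTower

section PointCount

open QuadraticAlgebra

/-- The nodes `(z, h)` of `q` are elements of the tower whose `h`-fold preimages under
`x ↦ a x ^ 2 + b`, with critical orbit `c`, are still to be adjoined, and `B` contains the
`y`-coordinates of the points at which some of these preimages ramify. -/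
structure QuadraticTower.Admissible {k R : Type} [Field k] [CommRing R] [Algebra k R]
    (T : QuadraticTower k R) (L : Type) [Field L] [Algebra k L] (c : ℕ → k) (r : ℕ) (B : Set k)
    (q : List (R × ℕ)) : Prop where
  deriv_ne : ∀ P : R →ₐ[k] k, P T.y ∉ B → P (T.D T.y) ≠ 0
  mem_F : ∀ z ∈ q, z.1 ∈ T.F 1
  height_le : ∀ z ∈ q, z.2 ≤ r
  critical : ∀ z ∈ q, ∀ P : R →ₐ[k] k, ∀ i < z.2, P z.1 = c (i + 1) → P T.y ∈ B
  deriv_map : ∀ z ∈ q, ∀ Q : R →ₐ[k] L, Q (T.D T.y) ≠ 0 → Q (T.D z.1) ≠ 0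
  exists_map : ∀ z ∈ q, ∀ i < z.2, ∃ Q : R →ₐ[k] L,
    Q z.1 = algebraMap k L (c (i + 1)) ∧ Q (T.D T.y) ≠ 0
  disjoint : q.Pairwise fun z z' => ∀ Q : R →ₐ[k] L, ∀ i < z.2, ∀ j < z'.2,
    Q z.1 = algebraMap k L (c (i + 1)) → Q z'.1 ≠ algebraMap k L (c (j + 1))

/-- The element whose square root is adjoined below the node `z`. -/
def branch {k R : Type} [Field k] [CommRing R] [Algebra k R] (b l : k) (z : R) : R :=
  l • (z - algebraMap k R b)

/-- The nodes of `q` viewed in a quadratic extension. -/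
def liftNodes {R : Type} [CommRing R] (g : R) (q : List (R × ℕ)) :
    List (QuadraticAlgebra R g 0 × ℕ) :=
  q.map fun z => (algebraMap R _ z.1, z.2)

namespace QuadraticTower

variable {k R L : Type} [Field k] [CommRing R] [Algebra k R] [Field L] [Algebra k L]
  {T : QuadraticTower k R} {c : ℕ → k} {r : ℕ} {B : Set k} {q : List (R × ℕ)} {a b l : k}
  {z : R} {h : ℕ}

theorem map_branch {A : Type} [CommRing A] [Algebra k A] (Q : R →ₐ[k] A) :
    Q (branch b l z) = l • (Q z - algebraMap k A b) := by
  simp [branch]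

theorem map_branch_eq_zero {A : Type} [Field A] [Algebra k A] (Q : R →ₐ[k] A) (hl : l ≠ 0) :
    Q (branch b l z) = 0 ↔ Q z = algebraMap k A b := by
  rw [map_branch, smul_eq_zero_iff_right hl, sub_eq_zero]

theorem derivation_branch : T.D (branch b l z) = l • T.D z := by
  simp [branch]

theorem branch_mem (hz : z ∈ T.F 1) : branch b l z ∈ T.F 1 := by
  refine Submodule.smul_mem _ _ (sub_mem hz ?_)
  rw [Algebra.algebraMap_eq_smul_one]
  exact Submodule.smul_mem _ _ (T.mono zero_le_one T.one_mem)

theorem Admissible.branch_nonsquare [IsDomain R] (hA : T.Admissible L c r B ((z, h + 1) :: q))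
    (hb : c 1 = b) (hl : l ≠ 0) (x s : R) (hs : s ≠ 0) : x ^ 2 ≠ s ^ 2 * branch b l z := by
  intro hx
  obtain ⟨e, he⟩ := T.dvd_of_sq
  obtain ⟨w, hw⟩ := he x s _ hs hx
  have hw2 : w ^ 2 = (T.D T.y ^ e) ^ 2 * branch b l z := by
    refine mul_left_cancel₀ (pow_ne_zero 2 hs) ?_
    rw [← mul_pow, ← hw, mul_pow, hx]
    ring
  obtain ⟨Q, hQ, hQu⟩ := hA.exists_map _ List.mem_cons_self 0 (Nat.succ_pos h)
  rw [hb] at hQ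
  have hQg : Q (branch b l z) = 0 := (map_branch_eq_zero Q hl).2 hQ
  have hQw : Q w = 0 := by
    have h1 := congrArg Q hw2
    rw [map_pow, map_mul, hQg, mul_zero] at h1
    exact pow_eq_zero_iff two_ne_zero |>.1 h1
  have h2 := congrArg (fun t => Q (T.D t)) hw2
  simp only [sq w, Derivation.leibniz, smul_eq_mul, map_add, map_mul, hQw, hQg, zero_mul, add_zero,
    derivation_branch, map_smul, map_pow] at h2
  exact (mul_ne_zero (pow_ne_zero 2 (pow_ne_zero e hQu)) (smul_ne_zero hl
    (hA.deriv_map _ List.mem_cons_self Q hQu))) h2.symm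

theorem mem_liftNodes {g : R} {w : QuadraticAlgebra R g 0 × ℕ} :
    w ∈ liftNodes g q ↔ ∃ z ∈ q, (algebraMap R _ z.1, z.2) = w := List.mem_map

theorem map_extend_D_algebraMap [IsDomain R] {g : R} (hg : g ∈ T.F 1)
    [IsDomain (QuadraticAlgebra R g 0)] {A : Type} [CommRing A] [Algebra k A]
    (Q : QuadraticAlgebra R g 0 →ₐ[k] A) (x : R) :
    Q ((T.extend hg).D (algebraMap R _ x)) =
      2 * restrictHom Q g * restrictHom Q (T.D x) := by
  change Q (extendDerivation T.D g _) = _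
  rw [extendDerivation_algebraMap, ← restrictHom_apply, map_mul, map_mul, map_ofNat]

theorem Admissible.lift [IsDomain R] [IsAlgClosed L]
    (hA : T.Admissible L c r B ((z, h + 1) :: q))
    (h2 : (2 : k) ≠ 0) (hb : c 1 = b) (hl : l ≠ 0) (hg : branch b l z ∈ T.F 1)
    [IsDomain (QuadraticAlgebra R (branch b l z) 0)] :
    (T.extend hg).Admissible L c r B (liftNodes _ q) where
  deriv_ne P hP := by
    change P (algebraMap R _ T.y) ∉ B at hP
    change P ((T.extend hg).D (algebraMap R _ T.y)) ≠ 0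
    rw [← restrictHom_apply] at hP
    rw [map_extend_D_algebraMap]
    refine mul_ne_zero (mul_ne_zero h2 fun h0 => hP ?_) (hA.deriv_ne _ hP)
    refine hA.critical _ List.mem_cons_self _ 0 (Nat.succ_pos h) ?_
    rw [hb]
    exact (map_branch_eq_zero _ hl).1 h0
  mem_F w hw := by
    obtain ⟨x, hx, rfl⟩ := mem_liftNodes.1 hw
    refine mem_extendF_succ.2 ⟨?_, ?_⟩
    · simpa using hA.mem_F x (List.mem_cons_of_mem _ hx)
    · simp
  height_le w hw := by
    obtain ⟨x, hx, rfl⟩ := mem_liftNodes.1 hw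
    exact hA.height_le x (List.mem_cons_of_mem _ hx)
  critical w hw P i hi hP := by
    obtain ⟨x, hx, rfl⟩ := mem_liftNodes.1 hw
    exact hA.critical x (List.mem_cons_of_mem _ hx) (restrictHom P) i hi hP
  deriv_map w hw Q hQ := by
    obtain ⟨x, hx, rfl⟩ := mem_liftNodes.1 hw
    change Q ((T.extend hg).D (algebraMap R _ T.y)) ≠ 0 at hQ
    rw [map_extend_D_algebraMap] at hQ ⊢
    exact mul_ne_zero (left_ne_zero_of_mul hQ)
      (hA.deriv_map x (List.mem_cons_of_mem _ hx) _ (right_ne_zero_of_mul hQ))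
  exists_map w hw i hi := by
    obtain ⟨x, hx, rfl⟩ := mem_liftNodes.1 hw
    obtain ⟨Q, hQ, hQu⟩ := hA.exists_map x (List.mem_cons_of_mem _ hx) i hi
    obtain ⟨s, hs⟩ := IsAlgClosed.exists_pow_nat_eq (Q (branch b l z)) (Nat.succ_pos 1)
    refine ⟨extendHom Q s hs, by rw [extendHom_algebraMap, hQ], ?_⟩
    change extendHom Q s hs ((T.extend hg).D (algebraMap R _ T.y)) ≠ 0
    rw [map_extend_D_algebraMap, restrictHom_extendHom]
    refine mul_ne_zero (mul_ne_zero ?_ fun h0 => ?_) hQu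
    · rw [← map_ofNat (algebraMap k L)]
      exact (map_ne_zero _).2 h2
    · rw [map_branch_eq_zero _ hl, ← hb] at h0
      exact (List.pairwise_cons.1 hA.disjoint).1 x hx Q 0 (Nat.succ_pos h) i hi h0 hQ
  disjoint := by
    refine List.pairwise_map.2 ((List.pairwise_cons.1 hA.disjoint).2.imp ?_)
    intro x w hxw Q
    exact hxw (restrictHom Q)

theorem map_eq_of_sq {A : Type} [Field A] [Algebra k A] (ha : a ≠ 0)
    (hc : ∀ i, c (i + 1) = a * c i ^ 2 + b) (Q : QuadraticAlgebra R (branch b a⁻¹ z) 0 →ₐ[k] A)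
    {i : ℕ} (hQ : Q omega ^ 2 = algebraMap k A (c i) ^ 2) :
    restrictHom Q z = algebraMap k A (c (i + 1)) := by
  have ha' : algebraMap k A a ≠ 0 := (map_ne_zero _).2 ha
  rw [map_omega_sq, map_branch, Algebra.smul_def, map_inv₀] at hQ
  rw [hc, map_add, map_mul, map_pow, ← hQ]
  field_simp
  ring

theorem Admissible.split [IsDomain R] [IsAlgClosed L]
    (hA : T.Admissible L c r B ((z, h + 1) :: q)) (h2 : (2 : k) ≠ 0) (ha : a ≠ 0)
    (hc0 : c 0 = 0) (hc : ∀ i, c (i + 1) = a * c i ^ 2 + b)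
    (hinj : ∀ i ≤ r, ∀ j ≤ r, c i = c j → i = j) (hg : branch b a⁻¹ z ∈ T.F 1)
    [IsDomain (QuadraticAlgebra R (branch b a⁻¹ z) 0)] :
    (T.extend hg).Admissible L c r B ((omega, h) :: (-omega, h) :: liftNodes _ q) := by
  have hb : c 1 = b := by rw [hc, hc0]; ring
  have hlift := hA.lift h2 hb (inv_ne_zero ha) hg
  have hr : h + 1 ≤ r := hA.height_le _ List.mem_cons_self
  have hroot : ∀ {A : Type} [Field A] [Algebra k A]
      (Q : QuadraticAlgebra R (branch b a⁻¹ z) 0 →ₐ[k] A) (w : QuadraticAlgebra R _ 0) (i : ℕ),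
      (w = omega ∨ w = -omega) → Q w = algebraMap k A (c i) →
      restrictHom Q z = algebraMap k A (c (i + 1)) := by
    intro A _ _ Q w i hw hQ
    refine map_eq_of_sq ha hc Q ?_
    rw [← hQ]
    rcases hw with rfl | rfl <;> simp
  have hinjL : ∀ i ≤ r, ∀ j ≤ r, algebraMap k L (c i) = algebraMap k L (c j) → i = j :=
    fun i hi j hj h => hinj i hi j hj ((algebraMap k L).injective h)
  have hne : ∀ i < r, c (i + 1) ≠ 0 := by
    intro i hi h0
    rw [← hc0] at h0
    exact Nat.succ_ne_zero i (hinj _ hi _ (Nat.zero_le r) h0)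
  have hmem : ∀ w ∈ ((omega, h) :: (-omega, h) :: liftNodes (branch b a⁻¹ z) q),
      ((w.1 = omega ∨ w.1 = -omega) ∧ w.2 = h) ∨ w ∈ liftNodes (branch b a⁻¹ z) q := by
    intro w hw
    rcases List.mem_cons.1 hw with rfl | hw
    · exact Or.inl ⟨Or.inl rfl, rfl⟩
    · rcases List.mem_cons.1 hw with rfl | hw
      · exact Or.inl ⟨Or.inr rfl, rfl⟩
      · exact Or.inr hw
  have hpair : ∀ w : QuadraticAlgebra R (branch b a⁻¹ z) 0, (w = omega ∨ w = -omega) →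
      ∀ w' ∈ liftNodes (branch b a⁻¹ z) q, ∀ Q : QuadraticAlgebra R _ 0 →ₐ[k] L, ∀ i < h,
      ∀ j < w'.2, Q w = algebraMap k L (c (i + 1)) → Q w'.1 ≠ algebraMap k L (c (j + 1)) := by
    intro w hw w' hw' Q i hi j hj hQ
    obtain ⟨x, hx, rfl⟩ := mem_liftNodes.1 hw'
    exact (List.pairwise_cons.1 hA.disjoint).1 x hx (restrictHom Q) (i + 1) (by simpa using hi) j hj
      (hroot Q w (i + 1) hw hQ)
  have homega : omega ∈ (T.extend hg).F 1 :=
    mem_extendF_succ.2 ⟨by simp, by simpa using T.one_mem⟩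
  refine ⟨hlift.deriv_ne, fun w hw => ?_, fun w hw => ?_, fun w hw P i hi hP => ?_,
    fun w hw Q hQ => ?_, fun w hw i hi => ?_, ?_⟩
  · rcases hmem w hw with ⟨hw | hw, -⟩ | hw
    · rwa [hw]
    · rw [hw]
      exact neg_mem homega
    · exact hlift.mem_F w hw
  · rcases hmem w hw with ⟨-, hw⟩ | hw
    · omega
    · exact hlift.height_le w hw
  · rcases hmem w hw with ⟨hw, hh⟩ | hw
    · exact hA.critical _ List.mem_cons_self (restrictHom P) (i + 1) (by simp; omega)
        (hroot P _ _ hw hP)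
    · exact hlift.critical w hw P i hi hP
  · rcases hmem w hw with ⟨hw, -⟩ | hw
    · have hQu := hQ
      change Q ((T.extend hg).D (algebraMap R _ T.y)) ≠ 0 at hQu
      rw [map_extend_D_algebraMap] at hQu
      have hQg := right_ne_zero_of_mul (left_ne_zero_of_mul hQu)
      have h1 : Q ((T.extend hg).D omega) ≠ 0 := by
        change Q (extendDerivation T.D _ omega) ≠ 0
        rw [extendDerivation_omega, map_mul, ← restrictHom_apply, derivation_branch, map_smul]
        refine mul_ne_zero (smul_ne_zero (inv_ne_zero ha)
          (hA.deriv_map _ List.mem_cons_self _ (right_ne_zero_of_mul hQu))) fun h0 => hQg ?_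
        rw [← map_omega_sq, h0]
        simp
      rcases hw with hw | hw
      · rwa [hw]
      · rw [hw, map_neg, map_neg]
        exact neg_ne_zero.2 h1
    · exact hlift.deriv_map w hw Q hQ
  · rcases hmem w hw with ⟨hw, hh⟩ | hw
    · obtain ⟨Q, hQ, hQu⟩ := hA.exists_map _ List.mem_cons_self (i + 1) (by simp; omega)
      have hsq : algebraMap k L (c (i + 1)) ^ 2 = Q (branch b a⁻¹ z) := by
        have ha' : algebraMap k L a ≠ 0 := (map_ne_zero _).2 ha
        rw [map_branch, hQ, hc (i + 1), Algebra.smul_def, map_inv₀, map_add, map_mul, map_pow]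
        field_simp
        ring
      have hci : algebraMap k L (c (i + 1)) ≠ 0 := (map_ne_zero _).2 (hne i (by omega))
      have hD : ∀ s hs, extendHom Q s hs ((T.extend hg).D (algebraMap R _ T.y)) ≠ 0 := by
        intro s hs
        rw [map_extend_D_algebraMap, restrictHom_extendHom, ← hsq]
        refine mul_ne_zero (mul_ne_zero ?_ (pow_ne_zero 2 hci)) hQu
        rw [← map_ofNat (algebraMap k L)]
        exact (map_ne_zero _).2 h2
      rcases hw with hw | hw
      · exact ⟨extendHom Q _ hsq, by rw [hw, extendHom_omega], hD _ _⟩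
      · refine ⟨extendHom Q (-algebraMap k L (c (i + 1))) (by rw [neg_sq, hsq]), ?_, hD _ _⟩
        rw [hw, map_neg, extendHom_omega, neg_neg]
    · exact hlift.exists_map w hw i hi
  · refine List.pairwise_cons.2 ⟨fun w' hw' => ?_, List.pairwise_cons.2
      ⟨hpair _ (Or.inr rfl), hlift.disjoint⟩⟩
    rcases List.mem_cons.1 hw' with rfl | hw'
    · intro Q i hi j hj hQ hQ'
      have h3 := (hroot Q _ _ (Or.inl rfl) hQ).symm.trans (hroot Q _ _ (Or.inr rfl) hQ')
      have h4 : i = j := by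
        have := hinjL _ (by omega) _ (by simp at hj; omega) h3
        omega
      subst h4
      rw [map_neg, hQ, ← map_neg] at hQ'
      have h5 := (algebraMap k L).injective hQ'
      refine hne i (by omega) ((mul_eq_zero.1 (?_ : 2 * c (i + 1) = 0)).resolve_left h2)
      linear_combination -h5
    · exact hpair _ (Or.inl rfl) w' hw'

end QuadraticTower

/-- The proportion of points missed by the `h`-th iterate of a generic quadratic map. -/
noncomputable def missProportion : ℕ → ℝ
  | 0 => 0
  | h + 1 => (1 + missProportion h ^ 2) / 2

theorem le_missProportion (h : ℕ) : 1 - 2 / ((h : ℝ) + 2) ≤ missProportion h := by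
  induction h with
  | zero => norm_num [missProportion]
  | succ h ih =>
    rw [missProportion]
    have h0 : (0 : ℝ) ≤ h := Nat.cast_nonneg h
    have h1 : (0 : ℝ) ≤ 1 - 2 / ((h : ℝ) + 2) := by
      rw [sub_nonneg, div_le_one (by positivity)]
      linarith
    have h2 : (1 - 2 / ((h : ℝ) + 2)) ^ 2 ≤ missProportion h ^ 2 := pow_le_pow_left₀ h1 ih 2
    have h3 : 1 - 2 / ((h : ℝ) + 1 + 2) ≤ (1 + (1 - 2 / ((h : ℝ) + 2)) ^ 2) / 2 := by
      rw [← sub_nonneg]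
      have h4 : (1 + (1 - 2 / ((h : ℝ) + 2)) ^ 2) / 2 - (1 - 2 / ((h : ℝ) + 1 + 2)) =
          2 / (((h : ℝ) + 2) ^ 2 * (h + 3)) := by
        field_simp
        ring
      rw [h4]
      positivity
    push_cast
    linarith

/-- The proportion of points missed by all the nodes of `q`. -/
noncomputable def missProduct {R : Type} (q : List (R × ℕ)) : ℝ :=
  (q.map fun z => missProportion z.2).prod

theorem missProduct_liftNodes {R : Type} [CommRing R] (g : R) (q : List (R × ℕ)) :
    missProduct (liftNodes g q) = missProduct q := by
  rw [missProduct, liftNodes, List.map_map]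
  rfl

theorem missProduct_cons {R : Type} (z : R × ℕ) (q : List (R × ℕ)) :
    missProduct (z :: q) = missProportion z.2 * missProduct q := by
  simp [missProduct]

/-- The number of square roots needed to split all the nodes of `q`. -/
def weight {R : Type} (q : List (R × ℕ)) : ℕ := (q.map fun z => 2 ^ z.2 - 1).sum

theorem weight_liftNodes {R : Type} [CommRing R] (g : R) (q : List (R × ℕ)) :
    weight (liftNodes g q) = weight q := by
  rw [weight, liftNodes, List.map_map]
  rfl

theorem weight_cons {R : Type} (z : R × ℕ) (q : List (R × ℕ)) :
    weight (z :: q) = (2 ^ z.2 - 1) + weight q := by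
  simp [weight]

namespace QuadraticTower

variable {k R : Type} [Field k] [CommRing R] [Algebra k R]

/-- The points at which the value of some node `(z, h)` of `q` is an `h`-th iterate. -/
def hits (T : QuadraticTower k R) (f : k → k) (B : Set k) (q : List (R × ℕ)) : Set (R →ₐ[k] k) :=
  {P | P T.y ∉ B ∧ ∃ z ∈ q, P z.1 ∈ Set.range f^[z.2]}

theorem two_mul_ncard_le [Finite k] [Finite (R →ₐ[k] k)] (h2 : (2 : k) ≠ 0) {g : R}
    (S : Set (R →ₐ[k] k)) (S' : Set (QuadraticAlgebra R g 0 →ₐ[k] k))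
    (hS : ∀ P ∈ S, P g ≠ 0 ∧ IsSquare (P g))
    (hS' : ∀ P ∈ S, ∀ s hs, extendHom P s hs ∈ S') : 2 * S.ncard ≤ S'.ncard := by
  have : Finite (QuadraticAlgebra R g 0 →ₐ[k] k) := finite_algHom
  have hroot : ∀ P : S, ∃ s : k, s ^ 2 = P.1 g := fun P => by
    obtain ⟨s, hs⟩ := (hS P.1 P.2).2
    exact ⟨s, by rw [hs, sq]⟩
  choose s hs using hroot
  let φ : S × Bool → S' := fun x => if x.2 then ⟨extendHom x.1.1 (s x.1) (hs x.1), hS' _ x.1.2 _ _⟩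
    else ⟨extendHom x.1.1 (-s x.1) (by rw [neg_sq, hs x.1]), hS' _ x.1.2 _ _⟩
  have hφ : Function.Injective φ := by
    have hres : ∀ x, restrictHom (φ x).1 = x.1.1 := by
      rintro ⟨P, _ | _⟩ <;> simp [φ, restrictHom_extendHom]
    have hne : ∀ P, s P ≠ -s P := by
      intro P h
      have h0 : s P = 0 := by
        have h3 : 2 * s P = 0 := by linear_combination h
        exact (mul_eq_zero.1 h3).resolve_left h2
      exact (hS P.1 P.2).1 (by rw [← hs P, h0, sq, mul_zero])
    have homega : ∀ x, (φ x).1 omega = if x.2 then s x.1 else -s x.1 := by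
      rintro ⟨P, _ | _⟩ <;> simp [φ, extendHom_omega]
    rintro ⟨P, ε⟩ ⟨P', ε'⟩ h
    have h1 : P = P' := by
      have := hres (P, ε)
      rw [h, hres] at this
      exact Subtype.ext this.symm
    subst h1
    have h3 := homega (P, ε)
    rw [h, homega] at h3
    have h4 := hne P
    have h5 := h4.symm
    clear hne homega hres
    rcases ε with _ | _ <;> rcases ε' with _ | _ <;> simp_all
  have h3 := Nat.card_le_card_of_injective φ hφ
  rwa [Nat.card_prod, Nat.card_coe_set_eq, Nat.card_coe_set_eq,
    Nat.card_eq_fintype_card (α := Bool), Fintype.card_bool, mul_comm] at h3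

variable {L : Type} [Field L] [Algebra k L] {T : QuadraticTower k R} {c : ℕ → k} {r : ℕ} {B : Set k}
  {q : List (R × ℕ)} {a b : k} {z : R} {h : ℕ}

theorem extendHom_mem_hits [IsDomain R] {f : k → k} {g : R} (hg : g ∈ T.F 1)
    [IsDomain (QuadraticAlgebra R g 0)] {q' : List (QuadraticAlgebra R g 0 × ℕ)}
    (hq : ∀ z ∈ liftNodes g q, z ∈ q') {P : R →ₐ[k] k} (hP : P ∈ T.hits f B q) (s : k)
    (hs : s ^ 2 = P g) : extendHom P s hs ∈ (T.extend hg).hits f B q' := by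
  obtain ⟨hy, w, hw, hPw⟩ := hP
  refine ⟨?_, _, hq _ (mem_liftNodes.2 ⟨w, hw, rfl⟩), ?_⟩
  · change extendHom P s hs (algebraMap R _ T.y) ∉ B
    rwa [extendHom_algebraMap]
  · rwa [extendHom_algebraMap]

theorem map_branch_eq_sq (ha : a ≠ 0) (P : R →ₐ[k] k) {t : k} (hP : P z = a * t ^ 2 + b) (l : k) :
    P (branch b (l * a⁻¹) z) = l * t ^ 2 := by
  rw [map_branch, hP, smul_eq_mul]
  change l * a⁻¹ * (a * t ^ 2 + b - b) = _
  field_simp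
  ring

end QuadraticTower

namespace QuadraticTower

variable {p : ℕ} [Fact p.Prime] {L : Type} [Field L] [Algebra (ZMod p) L] [IsAlgClosed L]

theorem ncard_hits_le {c : ℕ → ZMod p} {r M : ℕ} {B : Set (ZMod p)} {a b : ZMod p} (hp2 : p ≠ 2)
    (ha : a ≠ 0) (hc0 : c 0 = 0) (hc : ∀ i, c (i + 1) = a * c i ^ 2 + b)
    (hinj : ∀ i ≤ r, ∀ j ≤ r, c i = c j → i = j)
    (hp : ∀ m ≤ M, 2 ^ m * (9 * (m + 1) + 2 ^ m * (m + 1) ^ 2 + 1) < p) (n : ℕ)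
    (R : Type) [CommRing R] [IsDomain R] [Algebra (ZMod p) R] [Finite (R →ₐ[ZMod p] ZMod p)]
    (T : QuadraticTower (ZMod p) R) (q : List (R × ℕ)) (hn : weight q < n)
    (hM : T.m + weight q ≤ M) (hA : T.Admissible L c r B q) :
    ((T.hits (fun x => a * x ^ 2 + b) B q).ncard : ℝ) ≤ 9 * p * (1 - missProduct q) := by
  induction n generalizing R with
  | zero => exact absurd hn (Nat.not_lt_zero _)
  | succ n ih =>
    have h2 : (2 : ZMod p) ≠ 0 := by
      have := Fact.out (p := p.Prime)
      intro h
      rw [← Nat.cast_ofNat, ZMod.natCast_eq_zero_iff] at h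
      exact hp2 ((Nat.prime_dvd_prime_iff_eq this Nat.prime_two).1 h)
    have hb : c 1 = b := by rw [hc, hc0]; ring
    match q, hn, hM, hA with
    | [], _, _, _ => simp [hits, missProduct]
    | (z, 0) :: q, _, hM, hA =>
      have hX := T.card_points_le
        (Set.toFinite (T.hits (fun x => a * x ^ 2 + b) B ((z, 0) :: q))).toFinset
        (fun P hP => hA.deriv_ne P ((Set.Finite.mem_toFinset _).1 hP).1)
        (hp _ ((Nat.le_add_right _ _).trans hM))
      rw [← Set.ncard_eq_toFinset_card] at hX
      rw [missProduct_cons, missProportion, zero_mul, sub_zero, mul_one]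
      exact_mod_cast hX
    | (z, h + 1) :: q, hn, hM, hA =>
      set f : ZMod p → ZMod p := fun x => a * x ^ 2 + b with hf
      set N := T.hits f B ((z, h + 1) :: q) with hN
      obtain ⟨ν, hν⟩ := FiniteField.exists_nonsquare (F := ZMod p)
        (by rwa [ZMod.ringChar_zmod_n])
      have hν0 : ν ≠ 0 := by
        rintro rfl
        exact hν IsSquare.zero
      have hl : ∀ l : ZMod p, l ≠ 0 → l * a⁻¹ ≠ 0 := fun l hl => mul_ne_zero hl (inv_ne_zero ha)
      have hz := hA.mem_F _ List.mem_cons_self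
      have hg : ∀ l, branch b l z ∈ T.F 1 := fun l => branch_mem hz
      have hdom : ∀ l : ZMod p, l ≠ 0 → IsDomain (QuadraticAlgebra R (branch b l z) 0) :=
        fun l hl => isDomain_of_nonsquare (hA.branch_nonsquare hb hl)
      have hne : ∀ P ∈ N, ∀ l : ZMod p, l ≠ 0 → P (branch b l z) ≠ 0 := by
        intro P hP l hl h0
        rw [map_branch_eq_zero _ hl] at h0
        exact hP.1 (hA.critical _ List.mem_cons_self P 0 (Nat.succ_pos h) (by rw [h0, hb]; rfl))
      have hw : 2 ^ (h + 1) - 1 = (2 ^ h - 1) + (2 ^ h - 1) + 1 := by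
        have := Nat.one_le_two_pow (n := h)
        omega
      rw [weight_cons] at hn hM
      simp only [hw] at hn hM
      have hsq : ∀ P ∈ N, P z ∈ Set.range f^[h + 1] →
          ∃ t ∈ Set.range f^[h], P (branch b a⁻¹ z) = t ^ 2 := by
        rintro P - ⟨x, hx⟩
        refine ⟨f^[h] x, ⟨x, rfl⟩, ?_⟩
        rw [Function.iterate_succ_apply'] at hx
        have := map_branch_eq_sq ha P hx.symm 1
        rwa [one_mul, one_mul] at this
      set S₁ := {P ∈ N | IsSquare (P (branch b a⁻¹ z))} with hS₁
      set S₂ := {P ∈ N | ¬ IsSquare (P (branch b a⁻¹ z))} with hS₂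
      have hN12 : N.ncard ≤ S₁.ncard + S₂.ncard := by
        refine (Set.ncard_le_ncard ?_ (Set.toFinite _)).trans (Set.ncard_union_le _ _)
        intro P hP
        by_cases h : IsSquare (P (branch b a⁻¹ z))
        · exact Or.inl ⟨hP, h⟩
        · exact Or.inr ⟨hP, h⟩
      have hcard₁ : 2 * (S₁.ncard : ℝ) ≤ 9 * p * (1 - missProportion h ^ 2 * missProduct q) := by
        have := hdom _ (inv_ne_zero ha)
        have := finite_algHom (k := ZMod p) (R := R) (g := branch b a⁻¹ z)
        have h3 := two_mul_ncard_le h2 S₁ ((T.extend (hg a⁻¹)).hits f B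
          ((omega, h) :: (-omega, h) :: liftNodes _ q))
          (fun P hP => ⟨hne P hP.1 _ (inv_ne_zero ha), hP.2⟩) (by
            rintro P ⟨hP, -⟩ s hs
            obtain ⟨hy, w, hw, hPw⟩ := id hP
            rcases List.mem_cons.1 hw with rfl | hw
            · refine ⟨?_, ?_⟩
              · change extendHom P s hs (algebraMap R _ T.y) ∉ B
                rwa [extendHom_algebraMap]
              · obtain ⟨t, ht, hPt⟩ := hsq P hP hPw
                rw [← hs] at hPt
                rcases sq_eq_sq_iff_eq_or_eq_neg.1 hPt with rfl | rfl
                · exact ⟨_, List.mem_cons_self, by rwa [extendHom_omega]⟩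
                · exact ⟨_, List.mem_cons_of_mem _ List.mem_cons_self, by
                    rwa [map_neg, extendHom_omega, neg_neg]⟩
            · exact extendHom_mem_hits (hg _) (fun x hx => List.mem_cons_of_mem _
                (List.mem_cons_of_mem _ hx)) (q := q) ⟨hy, w, hw, hPw⟩ s hs)
        have h4 := ih _ (T.extend (hg a⁻¹)) ((omega, h) :: (-omega, h) :: liftNodes _ q)
          (by simp only [weight_cons, weight_liftNodes]; omega)
          (by
            change T.m + 1 + _ ≤ M
            simp only [weight_cons, weight_liftNodes]; omega)
          (hA.split h2 ha hc0 hc hinj (hg _))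
        simp only [missProduct_cons, missProduct_liftNodes, ← mul_assoc, ← sq] at h4
        refine le_trans ?_ h4
        exact_mod_cast h3
      have hcard₂ : 2 * (S₂.ncard : ℝ) ≤ 9 * p * (1 - missProduct q) := by
        have := hdom _ (hl ν hν0)
        have := finite_algHom (k := ZMod p) (R := R) (g := branch b (ν * a⁻¹) z)
        have h3 := two_mul_ncard_le h2 S₂ ((T.extend (hg (ν * a⁻¹))).hits f B (liftNodes _ q))
          (fun P hP => ⟨hne P hP.1 _ (hl ν hν0), by
            have h5 : P (branch b (ν * a⁻¹) z) = ν * P (branch b a⁻¹ z) := by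
              rw [map_branch, map_branch, mul_smul, smul_eq_mul (a := ν)]
            rw [h5, ← quadraticChar_one_iff_isSquare
              (mul_ne_zero hν0 (hne P hP.1 _ (inv_ne_zero ha))), map_mul,
              quadraticChar_neg_one_iff_not_isSquare.2 hν,
              quadraticChar_neg_one_iff_not_isSquare.2 hP.2]
            rfl⟩) (by
            rintro P ⟨hP, hPs⟩ s hs
            obtain ⟨hy, w, hw, hPw⟩ := id hP
            rcases List.mem_cons.1 hw with rfl | hw
            · obtain ⟨t, -, hPt⟩ := hsq P hP hPw
              exact absurd ⟨t, by rw [hPt, sq]⟩ hPs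
            · exact extendHom_mem_hits (hg _) (fun x hx => hx) (q := q) ⟨hy, w, hw, hPw⟩ s hs)
        have h4 := ih _ (T.extend (hg (ν * a⁻¹))) (liftNodes _ q)
          (by simp only [weight_liftNodes]; omega)
          (by
            change T.m + 1 + _ ≤ M
            simp only [weight_liftNodes]; omega)
          (hA.lift h2 hb (hl ν hν0) (hg _))
        simp only [missProduct_liftNodes] at h4
        refine le_trans ?_ h4
        exact_mod_cast h3
      have hN12' : (N.ncard : ℝ) ≤ S₁.ncard + S₂.ncard := by exact_mod_cast hN12
      rw [missProduct_cons, missProportion]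
      linarith

end QuadraticTower

theorem finite_polynomial_algHom (k : Type) [Field k] [Finite k] :
    Finite (Polynomial k →ₐ[k] k) :=
  Finite.of_injective (fun P => P Polynomial.X) fun _ _ h => Polynomial.algHom_ext h

theorem QuadraticTower.base_admissible {k : Type} (L : Type) [Field k] [Field L] [Algebra k L]
    (c : ℕ → k) (r : ℕ) :
    (base k).Admissible L c r ((fun i => c (i + 1)) '' Set.Iio r) [(Polynomial.X, r)] where
  deriv_ne P _ := by
    change P (Polynomial.derivative Polynomial.X) ≠ 0
    simp
  mem_F z hz := by
    obtain rfl := List.mem_singleton.1 hz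
    change Polynomial.X ∈ Polynomial.degreeLT k 2
    rw [Polynomial.mem_degreeLT, Polynomial.degree_X]
    norm_num
  height_le z hz := by
    obtain rfl := List.mem_singleton.1 hz
    exact le_rfl
  critical z hz P i hi hP := by
    obtain rfl := List.mem_singleton.1 hz
    exact ⟨i, hi, hP.symm⟩
  deriv_map z hz Q hQ := by
    obtain rfl := List.mem_singleton.1 hz
    exact hQ
  exists_map z hz i _ := by
    obtain rfl := List.mem_singleton.1 hz
    refine ⟨Polynomial.aeval (algebraMap k L (c (i + 1))), Polynomial.aeval_X _, ?_⟩
    change Polynomial.aeval _ (Polynomial.derivative Polynomial.X) ≠ 0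
    simp
  disjoint := List.pairwise_singleton _ _

theorem ncard_range_iterate_le {p : ℕ} [Fact p.Prime] {c : ℕ → ZMod p} {r : ℕ} {a b : ZMod p}
    (hp2 : p ≠ 2) (ha : a ≠ 0) (hc0 : c 0 = 0) (hc : ∀ i, c (i + 1) = a * c i ^ 2 + b)
    (hinj : ∀ i ≤ r, ∀ j ≤ r, c i = c j → i = j)
    (hp : ∀ m < 2 ^ r, 2 ^ m * (9 * (m + 1) + 2 ^ m * (m + 1) ^ 2 + 1) < p) :
    ((Set.range (fun x => a * x ^ 2 + b)^[r]).ncard : ℝ) ≤ r + 18 * p / (r + 2) := by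
  have := finite_polynomial_algHom (ZMod p)
  set B : Set (ZMod p) := (fun i => c (i + 1)) '' Set.Iio r with hB
  set S := (QuadraticTower.base (ZMod p)).hits (fun x => a * x ^ 2 + b) B [(Polynomial.X, r)]
    with hS
  have hw : weight [((Polynomial.X : Polynomial (ZMod p)), r)] = 2 ^ r - 1 := by simp [weight]
  have hpos := Nat.one_le_two_pow (n := r)
  have h1 := QuadraticTower.ncard_hits_le (L := AlgebraicClosure (ZMod p)) (M := 2 ^ r - 1)
    hp2 ha hc0 hc hinj (fun m hm => hp m (by omega)) (2 ^ r) _ (QuadraticTower.base (ZMod p))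
    [(Polynomial.X, r)] (by omega)
    (by
      change 0 + _ ≤ _
      omega)
    (QuadraticTower.base_admissible _ c r)
  have hBr : B.ncard ≤ r := by
    refine (Set.ncard_image_le (Set.finite_Iio r)).trans ?_
    rw [Set.ncard_eq_toFinset_card']
    simp
  have hsub : Set.range (fun x => a * x ^ 2 + b)^[r] ⊆
      B ∪ (fun P : Polynomial (ZMod p) →ₐ[ZMod p] ZMod p => P Polynomial.X) '' S := by
    intro x hx
    by_cases hxB : x ∈ B
    · exact Or.inl hxB
    · refine Or.inr ⟨Polynomial.aeval x, ⟨?_, _, List.mem_singleton_self _, ?_⟩,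
        Polynomial.aeval_X x⟩
      · change Polynomial.aeval x Polynomial.X ∉ B
        rwa [Polynomial.aeval_X]
      · rwa [Polynomial.aeval_X]
  have h2 : (Set.range (fun x => a * x ^ 2 + b)^[r]).ncard ≤ r + S.ncard :=
    (Set.ncard_le_ncard hsub (Set.toFinite _)).trans ((Set.ncard_union_le _ _).trans
      (add_le_add hBr (Set.ncard_image_le (Set.toFinite _))))
  have h3 : ((Set.range (fun x => a * x ^ 2 + b)^[r]).ncard : ℝ) ≤ r + S.ncard := by
    exact_mod_cast h2
  have h4 := le_missProportion r
  have h5 : missProduct [((Polynomial.X : Polynomial (ZMod p)), r)] = missProportion r := by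
    simp [missProduct]
  rw [h5] at h1
  have h6 : 9 * (p : ℝ) * (1 - missProportion r) ≤ 9 * p * (2 / (r + 2)) :=
    mul_le_mul_of_nonneg_left (by linarith) (by positivity)
  have h7 : 9 * (p : ℝ) * (2 / (r + 2)) = 18 * p / (r + 2) := by ring
  linarith

end PointCount

/-- The orbit of the critical point of `x ↦ a x ^ 2 + b`. -/
def criticalOrbit (a b : ℤ) : ℕ → ℤ
  | 0 => 0
  | i + 1 => a * criticalOrbit a b i ^ 2 + b

theorem criticalOrbit_nonneg {a b : ℤ} (ha : 0 < a) (hb : 0 < b) (i : ℕ) :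
    0 ≤ criticalOrbit a b i := by
  cases i with
  | zero => exact le_rfl
  | succ i => rw [criticalOrbit]; positivity

theorem criticalOrbit_strictMono {a b : ℤ} (ha : 0 < a) (hb : 0 < b) :
    StrictMono (criticalOrbit a b) := by
  refine strictMono_nat_of_lt_succ fun i => ?_
  rw [criticalOrbit]
  have h := criticalOrbit_nonneg ha hb i
  generalize criticalOrbit a b i = x at *
  have h1 : x ≤ x ^ 2 := by
    rcases h.eq_or_lt with rfl | h
    · norm_num
    · nlinarith
  nlinarith [mul_le_mul_of_nonneg_right (show 1 ≤ a from ha) (sq_nonneg x)]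

theorem mul_criticalOrbit_le {a b : ℤ} (ha : 0 < a) (hb : 0 < b) (i : ℕ) :
    (a + b) * criticalOrbit a b i ≤ (a + b) ^ 2 ^ i := by
  induction i with
  | zero =>
    rw [criticalOrbit, mul_zero]
    positivity
  | succ i ih =>
    rw [criticalOrbit, pow_succ 2, pow_mul]
    have hK : 0 < a + b := by omega
    have hX : a + b ≤ (a + b) ^ 2 ^ i := le_self_pow₀ (by omega) (by positivity)
    have hc := criticalOrbit_nonneg ha hb i
    generalize (a + b) ^ 2 ^ i = X at *
    generalize criticalOrbit a b i = x at *
    refine le_of_mul_le_mul_left ?_ hK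
    have h1 : ((a + b) * x) ^ 2 ≤ X ^ 2 := pow_le_pow_left₀ (by positivity) ih 2
    have h2 : (a + b) ^ 2 ≤ X ^ 2 := pow_le_pow_left₀ hK.le hX 2
    nlinarith [mul_le_mul_of_nonneg_left h1 ha.le, mul_le_mul_of_nonneg_left h2 hb.le]

theorem criticalOrbit_lt {a b : ℤ} (ha : 0 < a) (hb : 0 < b) (i : ℕ) :
    criticalOrbit a b i < (a + b) ^ 2 ^ i := by
  have h1 := mul_criticalOrbit_le ha hb i
  have h2 := criticalOrbit_nonneg ha hb i
  have h3 : 0 < (a + b) ^ 2 ^ i := by positivity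
  nlinarith

theorem criticalOrbit_injective_mod {a b : ℤ} (ha : 0 < a) (hb : 0 < b) {p r : ℕ}
    (hp : (a + b) ^ 2 ^ r ≤ p) (i : ℕ) (hi : i ≤ r) (j : ℕ) (hj : j ≤ r)
    (h : (criticalOrbit a b i : ZMod p) = criticalOrbit a b j) : i = j := by
  have hlt : ∀ i ≤ r, criticalOrbit a b i < p := fun i hi =>
    ((criticalOrbit_strictMono ha hb).monotone hi).trans_lt
      ((criticalOrbit_lt ha hb r).trans_le hp)
  rw [ZMod.intCast_eq_intCast_iff] at h
  have h1 : criticalOrbit a b i % p = criticalOrbit a b j % p := h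
  rw [Int.emod_eq_of_lt (criticalOrbit_nonneg ha hb i) (hlt i hi),
    Int.emod_eq_of_lt (criticalOrbit_nonneg ha hb j) (hlt j hj)] at h1
  exact (criticalOrbit_strictMono ha hb).injective h1

theorem tower_bound_lt {m n : ℕ} (hm : m < n) :
    2 ^ m * (9 * (m + 1) + 2 ^ m * (m + 1) ^ 2 + 1) < 16 ^ n := by
  have h1 : m + 1 ≤ 2 ^ m := Nat.lt_two_pow_self
  have h2 : 16 ^ (m + 1) ≤ 16 ^ n := Nat.pow_le_pow_right (by norm_num) hm
  refine lt_of_lt_of_le ?_ h2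
  have h3 : 16 ^ (m + 1) = 16 * ((2 ^ m) ^ 2 * (2 ^ m) ^ 2) := by
    rw [pow_succ, show 16 = 2 ^ 4 by norm_num, ← pow_mul, ← pow_mul, ← pow_add, mul_comm]
    ring
  rw [h3]
  generalize 2 ^ m = x at *
  have h4 : (m + 1) ^ 2 ≤ x ^ 2 := Nat.pow_le_pow_left h1 2
  have h5 : 1 ≤ x := by omega
  have h6 : x ^ 2 * (m + 1) ^ 2 ≤ x ^ 2 * x ^ 2 := Nat.mul_le_mul_left _ h4
  have h7 : x * (m + 1) ≤ x ^ 2 := by nlinarith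
  have h8 : 1 ≤ x ^ 2 := Nat.one_le_pow _ _ h5
  have h9 : x ^ 2 ≤ x ^ 2 * x ^ 2 := by nlinarith
  have h10 : x ≤ x ^ 2 := by nlinarith
  nlinarith

theorem mul_add_two_le (r : ℕ) : r * (r + 2) ≤ 16 ^ 2 ^ r := by
  have h1 : r + 1 ≤ 2 ^ r := Nat.lt_two_pow_self
  generalize 2 ^ r = n at *
  have h2 : n + 1 ≤ 2 ^ n := Nat.lt_two_pow_self
  have h3 : 16 ^ n = (2 ^ n) ^ 2 * (2 ^ n) ^ 2 := by
    rw [← pow_mul, ← pow_add, show 16 = 2 ^ 4 by norm_num, ← pow_mul]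
    congr 1
    ring
  rw [h3]
  generalize 2 ^ n = x at *
  have h4 : 1 ≤ x ^ 2 := Nat.one_le_pow _ _ (by omega)
  have h5 : r * (r + 2) ≤ x ^ 2 := by nlinarith
  nlinarith

theorem ncard_orbit_le {k : Type} [Finite k] (f : k → k) (x : k) (r : ℕ) :
    {y | ∃ n : ℕ, f^[n] x = y}.ncard ≤ r + (Set.range f^[r]).ncard := by
  have hsub : {y | ∃ n : ℕ, f^[n] x = y} ⊆ (fun n => f^[n] x) '' Set.Iio r ∪ Set.range f^[r] := by
    rintro y ⟨n, rfl⟩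
    by_cases hn : n < r
    · exact Or.inl ⟨n, hn, rfl⟩
    · refine Or.inr ⟨f^[n - r] x, ?_⟩
      rw [← Function.iterate_add_apply]
      congr 2
      omega
  refine (Set.ncard_le_ncard hsub (Set.toFinite _)).trans ((Set.ncard_union_le _ _).trans
    (Nat.add_le_add_right ((Set.ncard_image_le (Set.finite_Iio r)).trans ?_) _))
  rw [Set.ncard_eq_toFinset_card']
  simp

theorem ncard_orbit_mod_le {a b : ℤ} (ha : 0 < a) (hb : 0 < b) (α : ℤ) {p r : ℕ} (hp : p.Prime)
    (hp2 : p ≠ 2) (hr : (a + b + 16) ^ 2 ^ r ≤ p) :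
    ({y : ZMod p | ∃ n : ℕ,
      (fun x : ZMod p => (a : ZMod p) * x ^ 2 + (b : ZMod p))^[n] (α : ZMod p) = y}.ncard : ℝ)
      ≤ 20 * p / (r + 2) := by
  have := Fact.mk hp
  have hK : (a + b) ^ 2 ^ r ≤ (p : ℤ) :=
    (pow_le_pow_left₀ (by omega) (by omega) _).trans hr
  have h16 : 16 ^ 2 ^ r ≤ p := by
    have : (16 : ℤ) ^ 2 ^ r ≤ p := (pow_le_pow_left₀ (by norm_num) (by omega) _).trans hr
    exact_mod_cast this
  have ha0 : (a : ZMod p) ≠ 0 := by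
    intro h
    rw [ZMod.intCast_zmod_eq_zero_iff_dvd] at h
    have h1 := Int.le_of_dvd ha h
    have h2 : a + b ≤ (a + b) ^ 2 ^ r := le_self_pow₀ (by omega) (by positivity)
    omega
  have h1 := ncard_range_iterate_le (c := fun i => (criticalOrbit a b i : ZMod p)) hp2 ha0
    (b := (b : ZMod p)) (by simp [criticalOrbit]) (fun i => by simp [criticalOrbit])
    (criticalOrbit_injective_mod ha hb hK) (fun m hm => (tower_bound_lt hm).trans_le h16)
  have h2 := ncard_orbit_le (fun x : ZMod p => (a : ZMod p) * x ^ 2 + (b : ZMod p)) α r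
  have h3 : ({y : ZMod p | ∃ n : ℕ,
      (fun x : ZMod p => (a : ZMod p) * x ^ 2 + (b : ZMod p))^[n] (α : ZMod p) = y}.ncard : ℝ) ≤
      r + ((Set.range (fun x : ZMod p => (a : ZMod p) * x ^ 2 + (b : ZMod p))^[r]).ncard : ℝ) := by
    exact_mod_cast h2
  have h4 : (r : ℝ) ≤ p / (r + 2) := by
    rw [le_div_iff₀ (by positivity)]
    exact_mod_cast (mul_add_two_le r).trans h16
  have h5 : 20 * (p : ℝ) / (r + 2) = 18 * p / (r + 2) + 2 * (p / (r + 2)) := by ring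
  linarith

/-- Heath-Brown: let f(x) = ax² + b with a, b positive integers. There is a
constant C = C(a, b) such that for every α ∈ ℤ and every odd prime p, the forward orbit of
α mod p under the reduction of f modulo p has at most C·p/log log p elements. -/
theorem heath_brown_orbit_bound (a b : ℤ) (ha : 0 < a) (hb : 0 < b) :
    ∃ C : ℝ, ∀ (α : ℤ) (p : ℕ), p.Prime → p ≠ 2 →
      (({y : ZMod p | ∃ n : ℕ,
          (fun x : ZMod p => (a : ZMod p) * x ^ 2 + (b : ZMod p))^[n] (α : ZMod p) = y}).ncard : ℝ)
        ≤ C * p / Real.log (Real.log p) := by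
  obtain ⟨E, hE⟩ := Int.eq_ofNat_of_zero_le (show 0 ≤ a + b + 16 by omega)
  have hE16 : 16 ≤ E := by omega
  have hE3 : (3 : ℝ) ≤ E := by exact_mod_cast (by omega : 3 ≤ E)
  have hlog : ∀ x : ℝ, 3 ≤ x → 1 < Real.log x := fun x hx => by
    rw [Real.lt_log_iff_exp_lt (by linarith)]
    exact Real.exp_one_lt_three.trans_le hx
  have hEE := Real.log_pos (hlog E hE3)
  refine ⟨20 * (1 + Real.log (Real.log E)), fun α p hp hp2 => ?_⟩
  have := Fact.mk hp
  have hp3 : (3 : ℝ) ≤ p := by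
    have := hp.two_le
    exact_mod_cast (by omega : 3 ≤ p)
  rw [le_div_iff₀ (Real.log_pos (hlog p hp3))]
  rcases lt_or_ge p E with hpE | hpE
  · have h1 : {y : ZMod p | ∃ n : ℕ,
        (fun x : ZMod p => (a : ZMod p) * x ^ 2 + (b : ZMod p))^[n] (α : ZMod p) = y}.ncard ≤ p :=
      (Set.ncard_le_card _).trans_eq (Nat.card_zmod p)
    have h2 : Real.log (Real.log p) ≤ Real.log (Real.log E) :=
      Real.log_le_log (by linarith [hlog p hp3])
        (Real.log_le_log (by linarith) (by exact_mod_cast hpE.le))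
    calc _ ≤ (p : ℝ) * Real.log (Real.log E) :=
          mul_le_mul (by exact_mod_cast h1) h2 (Real.log_pos (hlog p hp3)).le (by positivity)
      _ ≤ _ := by nlinarith
  · set s := Nat.log E p with hs
    set r := Nat.log 2 s with hr
    have hs0 : s ≠ 0 := (Nat.log_pos (by omega) hpE).ne'
    have h1 : E ^ 2 ^ r ≤ p := (Nat.pow_le_pow_right (by omega) (Nat.pow_log_le_self 2 hs0)).trans
      (Nat.pow_log_le_self E hp.ne_zero)
    have h2 : p ≤ E ^ 2 ^ (r + 1) := ((Nat.lt_pow_succ_log_self (by omega) p).le).trans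
      (Nat.pow_le_pow_right (by omega) (Nat.lt_pow_succ_log_self (by norm_num) s))
    have h3 := ncard_orbit_mod_le ha hb α hp hp2 (r := r) (by
      rw [hE]
      exact_mod_cast h1)
    have h4 : Real.log p ≤ 2 ^ (r + 1) * Real.log E := by
      have h2' : (p : ℝ) ≤ (E : ℝ) ^ 2 ^ (r + 1) := by exact_mod_cast h2
      refine (Real.log_le_log (by linarith) h2').trans_eq ?_
      rw [Real.log_pow]
      push_cast
      rfl
    have h5 : Real.log (Real.log p) ≤ (r + 1) * Real.log 2 + Real.log (Real.log E) := by
      refine (Real.log_le_log (by linarith [hlog p hp3]) h4).trans_eq ?_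
      rw [Real.log_mul (by positivity) (by linarith [hlog E hE3]), Real.log_pow]
      push_cast
      rfl
    have h6 : Real.log (Real.log p) ≤ (r + 2) * (1 + Real.log (Real.log E)) := by
      have hr0 : (0 : ℝ) ≤ r := Nat.cast_nonneg r
      have hl2 : Real.log 2 ≤ 1 := by linarith [Real.log_two_lt_d9]
      nlinarith [mul_nonneg hr0 hEE.le]
    calc _ ≤ 20 * (p : ℝ) / (r + 2) * ((r + 2) * (1 + Real.log (Real.log E))) :=
          mul_le_mul h3 h6 (Real.log_pos (hlog p hp3)).le (by positivity)
      _ = _ := by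
        field_simp
end

section
/- Let d ≥ 2 and let c ∈ ℚ with c ∉ {0, −1, −2}, and set f(x) = x^d + c. For each n ≥ 1, let a_n ∈ ℤ be the numerator of f^n(0) written in lowest terms. Then the Zsigmondy set of the sequence (a_n)_{n ≥ 1} has at most 23 elements; that is, there are at most 23 indices n with a_n ≠ 0 such that every prime dividing a_n also divides a_k for some k < n with a_k ≠ 0. -/
/-- The numerator of f^n(0) for f(x) = x^d + c. -/
def kriegerNum (d : ℕ) (c : ℚ) (n : ℕ) : ℤ :=
  ((fun x : ℚ => x ^ d + c)^[n] 0).num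

/-- The Zsigmondy set of the sequence of numerators of f^n(0), f(x) = x^d + c: indices
n ≥ 1 with a_n ≠ 0 such that every prime dividing a_n divides some earlier nonzero a_k. -/
def kriegerZsig (d : ℕ) (c : ℚ) : Set ℕ :=
  {n : ℕ | 1 ≤ n ∧ kriegerNum d c n ≠ 0 ∧
    ∀ p : ℕ, p.Prime → (p : ℤ) ∣ kriegerNum d c n →
      ∃ k : ℕ, 1 ≤ k ∧ k < n ∧ kriegerNum d c k ≠ 0 ∧ (p : ℤ) ∣ kriegerNum d c k}

section Arithmetic

variable {d : ℕ} {c : ℚ}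

lemma kriegerNum_zero : kriegerNum d c 0 = 0 := by simp [kriegerNum]

lemma den_iterate_and_kriegerNum_succ (hd : 2 ≤ d) (n : ℕ) :
    ((fun x : ℚ => x ^ d + c)^[n + 1] 0).den = c.den ^ d ^ n ∧
      kriegerNum d c (n + 1) =
        kriegerNum d c n ^ d + c.num * (c.den : ℤ) ^ (d ^ n - 1) := by
  induction n with
  | zero => simp [kriegerNum, show d ≠ 0 by omega]
  | succ n ih =>
    obtain ⟨hden, -⟩ := ih
    have hb : (0 : ℤ) < c.den := by exact_mod_cast c.den_pos
    have hbq : (c.den : ℚ) ≠ 0 := by exact_mod_cast c.den_ne_zero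
    have hN : 2 ≤ d ^ (n + 1) := hd.trans (Nat.le_self_pow (by omega) d)
    have hcop : IsCoprime (kriegerNum d c (n + 1)) (c.den : ℤ) := by
      have h := ((fun x : ℚ => x ^ d + c)^[n + 1] 0).isCoprime_num_den
      rw [hden, Nat.cast_pow] at h
      exact (IsCoprime.pow_right_iff (by positivity)).1 h
    have hcop' : IsCoprime (kriegerNum d c (n + 1) ^ d +
        c.num * (c.den : ℤ) ^ (d ^ (n + 1) - 1)) ((c.den : ℤ) ^ d ^ (n + 1)) := by
      apply IsCoprime.pow_right
      obtain ⟨e, he⟩ : ∃ e, d ^ (n + 1) - 1 = e + 1 := ⟨d ^ (n + 1) - 2, by omega⟩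
      rw [he, pow_succ, ← mul_assoc]
      exact IsCoprime.add_mul_right_left hcop.pow_left _
    have hx : (fun x : ℚ => x ^ d + c)^[n + 1 + 1] 0 =
        ((kriegerNum d c (n + 1) ^ d + c.num * (c.den : ℤ) ^ (d ^ (n + 1) - 1) : ℤ) : ℚ) /
          (((c.den : ℤ) ^ d ^ (n + 1) : ℤ) : ℚ) := by
      rw [Function.iterate_succ_apply']
      have h1 := Rat.num_div_den ((fun x : ℚ => x ^ d + c)^[n + 1] 0)
      rw [hden] at h1
      have h2 := Rat.num_div_den c
      obtain ⟨e, he⟩ : ∃ e, d ^ (n + 1) = e + 1 := ⟨d ^ (n + 1) - 1, by omega⟩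
      push_cast at h1 ⊢
      change _ ^ d + c = _
      rw [← h1, div_pow, ← pow_mul, ← pow_succ, he, Nat.add_sub_cancel]
      nth_rewrite 3 [← h2]
      rw [kriegerNum]
      field_simp
      ring
    have hpos : (0 : ℤ) < (c.den : ℤ) ^ d ^ (n + 1) := by positivity
    have hcop'' := Int.isCoprime_iff_gcd_eq_one.1 hcop'
    refine ⟨?_, ?_⟩
    · have := Rat.den_div_eq_of_coprime hpos hcop''
      rw [← hx] at this
      exact_mod_cast this
    · have := Rat.num_div_eq_of_coprime hpos hcop''
      rw [← hx] at this
      exact this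

lemma kriegerNum_succ (hd : 2 ≤ d) (n : ℕ) :
    kriegerNum d c (n + 1) = kriegerNum d c n ^ d + c.num * (c.den : ℤ) ^ (d ^ n - 1) :=
  (den_iterate_and_kriegerNum_succ hd n).2

lemma isCoprime_kriegerNum_den (hd : 2 ≤ d) (n : ℕ) :
    IsCoprime (kriegerNum d c (n + 1)) (c.den : ℤ) := by
  have h := ((fun x : ℚ => x ^ d + c)^[n + 1] 0).isCoprime_num_den
  rw [(den_iterate_and_kriegerNum_succ hd n).1, Nat.cast_pow] at h
  exact (IsCoprime.pow_right_iff (by positivity)).1 h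

lemma iterate_mul_den_pow (hd : 2 ≤ d) (n : ℕ) :
    (fun x : ℚ => x ^ d + c)^[n + 1] 0 * (c.den : ℚ) ^ d ^ n = kriegerNum d c (n + 1) := by
  have h := Rat.mul_den_eq_num ((fun x : ℚ => x ^ d + c)^[n + 1] 0)
  rw [(den_iterate_and_kriegerNum_succ hd n).1] at h
  exact_mod_cast h

lemma abs_iterate_mul_den_pow (hd : 2 ≤ d) (n : ℕ) :
    |(fun x : ℚ => x ^ d + c)^[n + 1] 0| * (c.den : ℚ) ^ d ^ n =
      ((|kriegerNum d c (n + 1)| : ℤ) : ℚ) := by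
  rw [Int.cast_abs, ← iterate_mul_den_pow hd n, abs_mul,
    abs_of_nonneg (by positivity : (0 : ℚ) ≤ (c.den : ℚ) ^ d ^ n)]

lemma pow_dvd_kriegerNum_add_sub (hd : 2 ≤ d) (m k : ℕ) :
    kriegerNum d c m ^ d ∣ kriegerNum d c (m + k + 1) -
      (c.den : ℤ) ^ (d ^ (m + k) - d ^ k) * kriegerNum d c (k + 1) := by
  induction k with
  | zero =>
    rw [kriegerNum_succ hd, kriegerNum_succ hd 0, kriegerNum_zero]
    simp [show d ≠ 0 by omega, mul_comm]
  | succ k ih =>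
    rw [kriegerNum_succ hd (m + (k + 1)), kriegerNum_succ hd (k + 1), ← add_assoc m k 1]
    have hle : d ^ (k + 1) ≤ d ^ (m + k + 1) := Nat.pow_le_pow_right (by omega) (by omega)
    have hpos : 0 < d ^ (k + 1) := by positivity
    have e1 : (c.den : ℤ) ^ (d ^ (m + k + 1) - 1) =
        (c.den : ℤ) ^ (d ^ (m + k + 1) - d ^ (k + 1)) * (c.den : ℤ) ^ (d ^ (k + 1) - 1) := by
      rw [← pow_add]; congr 1; omega
    have e2 : (c.den : ℤ) ^ (d ^ (m + k + 1) - d ^ (k + 1)) =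
        ((c.den : ℤ) ^ (d ^ (m + k) - d ^ k)) ^ d := by
      rw [← pow_mul, Nat.sub_mul, pow_succ, pow_succ]
    have h := ih.trans (sub_dvd_pow_sub_pow (kriegerNum d c (m + k + 1))
      ((c.den : ℤ) ^ (d ^ (m + k) - d ^ k) * kriegerNum d c (k + 1)) d)
    rw [mul_pow, ← e2] at h
    rw [e1]
    refine h.trans (dvd_of_eq ?_)
    ring

lemma dvd_kriegerNum_add_iff (hd : 2 ≤ d) {P : ℤ} {m : ℕ} (hP : IsCoprime P (c.den : ℤ))
    (hm : P ∣ kriegerNum d c m ^ 2) (k : ℕ) :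
    P ∣ kriegerNum d c (m + k + 1) ↔ P ∣ kriegerNum d c (k + 1) := by
  have h := (hm.trans (pow_dvd_pow _ hd)).trans (pow_dvd_kriegerNum_add_sub (c := c) hd m k)
  have hPu : IsCoprime P ((c.den : ℤ) ^ (d ^ (m + k) - d ^ k)) := hP.pow_right
  exact (dvd_iff_dvd_of_dvd_sub h).trans ⟨hPu.dvd_of_dvd_mul_left, fun h' => h'.mul_left _⟩

lemma dvd_kriegerNum_mul_add_iff (hd : 2 ≤ d) {P : ℤ} {m : ℕ} (hP : IsCoprime P (c.den : ℤ))
    (hm : P ∣ kriegerNum d c m ^ 2) (q k : ℕ) :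
    P ∣ kriegerNum d c (m * q + k + 1) ↔ P ∣ kriegerNum d c (k + 1) := by
  induction q with
  | zero => simp
  | succ q ih =>
    rw [show m * (q + 1) + k + 1 = m + (m * q + k) + 1 by ring,
      dvd_kriegerNum_add_iff hd hP hm, ih]

lemma kriegerNum_dvd_prod (hd : 2 ≤ d) {n : ℕ} (hn : n ∈ kriegerZsig d c) :
    kriegerNum d c n ∣ ∏ i ∈ Finset.range (n / 2), kriegerNum d c (i + 1) := by
  obtain ⟨hn1, -, hprim⟩ := hn
  rw [← Int.natAbs_dvd_natAbs, Nat.dvd_iff_prime_pow_dvd_dvd]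
  intro p t hp ht
  rw [← Int.natCast_dvd] at ht ⊢
  push_cast at ht ⊢
  rcases Nat.eq_zero_or_pos t with rfl | htpos
  · simp
  have hpn : (p : ℤ) ∣ kriegerNum d c n := (dvd_pow_self _ htpos.ne').trans ht
  have hex : ∃ k, 1 ≤ k ∧ (p : ℤ) ∣ kriegerNum d c k := ⟨n, hn1, hpn⟩
  classical
  obtain ⟨hk1, hpk⟩ := Nat.find_spec hex
  have hmin : ∀ j, 1 ≤ j → (p : ℤ) ∣ kriegerNum d c j → Nat.find hex ≤ j :=
    fun j h1 h2 => Nat.find_min' hex ⟨h1, h2⟩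
  generalize Nat.find hex = k at *
  have hpb : IsCoprime (p : ℤ) (c.den : ℤ) := by
    obtain ⟨k, rfl⟩ : ∃ l, k = l + 1 := ⟨k - 1, by omega⟩
    exact (isCoprime_kriegerNum_den hd k).of_isCoprime_of_dvd_left hpk
  have hkn : k < n := by
    obtain ⟨j, hj1, hjn, -, hj⟩ := hprim p hp hpn
    exact (hmin j hj1 hj).trans_lt hjn
  have hdecomp : k * ((n - 1) / k) + (n - 1) % k + 1 = n := by
    have := Nat.div_add_mod (n - 1) k
    omega
  have hr : (n - 1) % k + 1 = k := by
    have h1 := Nat.mod_lt (n - 1) (show 0 < k by omega)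
    have h2 := (dvd_kriegerNum_mul_add_iff hd hpb (dvd_pow hpk two_ne_zero) _ _).1
      (hdecomp.symm ▸ hpn)
    have h3 := hmin _ (by omega) h2
    omega
  have hk2 : k ≤ n / 2 := by
    have hq : k * ((n - 1) / k) + k = n := by omega
    have : (n - 1) / k ≠ 0 := by
      intro h0
      rw [h0] at hq
      omega
    have : k * 1 ≤ k * ((n - 1) / k) := Nat.mul_le_mul_left k (Nat.pos_of_ne_zero this)
    omega
  have hpt : (p : ℤ) ^ t ∣ kriegerNum d c k := by
    have key : ∀ e, 1 ≤ e → e ≤ t → (p : ℤ) ^ e ∣ kriegerNum d c k := by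
      intro e he
      induction e, he using Nat.le_induction with
      | base => intro _; simpa using hpk
      | succ e he ih =>
        intro het
        have hsq : (p : ℤ) ^ (e + 1) ∣ kriegerNum d c k ^ 2 := by
          refine (pow_dvd_pow (p : ℤ) (show e + 1 ≤ e * 2 by omega)).trans ?_
          rw [pow_mul]
          exact pow_dvd_pow_of_dvd (ih (by omega)) 2
        have h := (dvd_kriegerNum_mul_add_iff hd hpb.pow_left hsq _ _).1
          (hdecomp.symm ▸ (pow_dvd_pow (p : ℤ) het).trans ht)
        rwa [hr] at h
    exact key t htpos le_rfl
  refine hpt.trans ?_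
  have := Finset.dvd_prod_of_mem (fun i => kriegerNum d c (i + 1))
    (Finset.mem_range.2 (show k - 1 < n / 2 by omega))
  simpa [Nat.sub_add_cancel hk1] using this

lemma two_mul_abs_kriegerNum_le (hd : 2 ≤ d) {h : ℤ} (hnum : |c.num| ≤ h)
    (hden : (c.den : ℤ) ≤ h) (n : ℕ) :
    2 * |kriegerNum d c (n + 1)| ≤ (2 * h) ^ d ^ n := by
  have hb : (0 : ℤ) < c.den := by exact_mod_cast c.den_pos
  induction n with
  | zero =>
    rw [kriegerNum_succ hd, kriegerNum_zero]
    simpa [show d ≠ 0 by omega] using hnum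
  | succ n ih =>
    rw [kriegerNum_succ hd]
    have hN : 2 ≤ d ^ (n + 1) := hd.trans (Nat.le_self_pow (by omega) d)
    have h1 : (2 * |kriegerNum d c (n + 1)|) ^ d ≤ (2 * h) ^ d ^ (n + 1) := by
      rw [pow_succ, pow_mul]
      exact pow_le_pow_left₀ (by positivity) ih d
    have h2 : |c.num * (c.den : ℤ) ^ (d ^ (n + 1) - 1)| ≤ h ^ d ^ (n + 1) := by
      rw [abs_mul, abs_of_nonneg (by positivity : (0 : ℤ) ≤ (c.den : ℤ) ^ (d ^ (n + 1) - 1))]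
      calc |c.num| * (c.den : ℤ) ^ (d ^ (n + 1) - 1)
          ≤ h * h ^ (d ^ (n + 1) - 1) := by gcongr; exact hb.le.trans hden
        _ = h ^ d ^ (n + 1) := by rw [← pow_succ']; congr 1; omega
    have h3 := abs_add_le (kriegerNum d c (n + 1) ^ d) (c.num * (c.den : ℤ) ^ (d ^ (n + 1) - 1))
    have h4 : (4 : ℤ) ≤ 2 ^ d := by
      calc (4 : ℤ) = 2 ^ 2 := by norm_num
        _ ≤ 2 ^ d := pow_le_pow_right₀ (by norm_num) hd
    have h5 : (4 : ℤ) ≤ 2 ^ d ^ (n + 1) := by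
      calc (4 : ℤ) = 2 ^ 2 := by norm_num
        _ ≤ 2 ^ d ^ (n + 1) := pow_le_pow_right₀ (by norm_num) hN
    rw [mul_pow] at h1
    rw [abs_pow] at h3
    have h6 : 4 * |kriegerNum d c (n + 1)| ^ d ≤ 2 ^ d * |kriegerNum d c (n + 1)| ^ d := by
      gcongr
    have h7 : 4 * h ^ d ^ (n + 1) ≤ (2 * h) ^ d ^ (n + 1) := by
      rw [mul_pow]
      have : 0 ≤ h ^ d ^ (n + 1) := pow_nonneg (hb.le.trans hden) _
      gcongr
    linarith

lemma abs_kriegerNum_le_of_mem (hd : 2 ≤ d) {h : ℤ} (hnum : |c.num| ≤ h)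
    (hden : (c.den : ℤ) ≤ h) (hne : ∀ k, kriegerNum d c (k + 1) ≠ 0)
    {n : ℕ} (hn : n ∈ kriegerZsig d c) :
    |kriegerNum d c n| ≤ (2 * h) ^ d ^ (n / 2) := by
  have hb : (0 : ℤ) < c.den := by exact_mod_cast c.den_pos
  have hprod : |kriegerNum d c n| ≤ |∏ i ∈ Finset.range (n / 2), kriegerNum d c (i + 1)| :=
    Int.le_of_dvd (abs_pos.2 (Finset.prod_ne_zero_iff.2 fun i _ => hne i))
      ((abs_dvd_abs _ _).2 (kriegerNum_dvd_prod hd hn))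
  refine hprod.trans ?_
  rw [Finset.abs_prod]
  calc ∏ i ∈ Finset.range (n / 2), |kriegerNum d c (i + 1)|
      ≤ ∏ i ∈ Finset.range (n / 2), (2 * h) ^ d ^ i := by
        refine Finset.prod_le_prod (fun i _ => abs_nonneg _) fun i _ => ?_
        have := two_mul_abs_kriegerNum_le hd hnum hden i
        linarith [abs_nonneg (kriegerNum d c (i + 1))]
    _ = (2 * h) ^ ∑ i ∈ Finset.range (n / 2), d ^ i := Finset.prod_pow_eq_pow_sum _ _ _
    _ ≤ (2 * h) ^ d ^ (n / 2) := by
        refine pow_le_pow_right₀ (by linarith) ?_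
        exact (Nat.geomSum_lt hd fun i hi => Finset.mem_range.1 hi).le

end Arithmetic

section Dynamics

variable {d : ℕ} {c : ℚ}

lemma abs_le_abs_iterate_of_two_le (hd : 2 ≤ d) (h : 2 ≤ |c| ^ (d - 1)) (n : ℕ) :
    |c| ≤ |(fun x : ℚ => x ^ d + c)^[n + 1] 0| := by
  induction n with
  | zero => simp [show d ≠ 0 by omega]
  | succ n ih =>
    rw [Function.iterate_succ_apply']
    generalize (fun x : ℚ => x ^ d + c)^[n + 1] 0 = x at ih
    have h1 : |c| ^ d ≤ |x ^ d| := by rw [abs_pow]; gcongr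
    have h2 : |c| ^ d = |c| ^ (d - 1) * |c| := by rw [← pow_succ]; congr 1; omega
    have h3 : 2 * |c| ≤ |c| ^ (d - 1) * |c| := by gcongr
    have h4 := abs_sub_abs_le_abs_sub (x ^ d) (-c)
    rw [abs_neg, sub_neg_eq_add] at h4
    linarith

lemma abs_le_abs_iterate_of_odd_or_pos (hd : 2 ≤ d) (hc0 : c ≠ 0) (h : Odd d ∨ 0 < c) (n : ℕ) :
    |c| ≤ |(fun x : ℚ => x ^ d + c)^[n + 1] 0| := by
  have key : c * c ≤ c * (fun x : ℚ => x ^ d + c)^[n + 1] 0 := by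
    induction n with
    | zero => simp [show d ≠ 0 by omega]
    | succ n ih =>
      rw [Function.iterate_succ_apply']
      generalize (fun x : ℚ => x ^ d + c)^[n + 1] 0 = x at ih
      have hcx : 0 ≤ c * x := (mul_self_nonneg c).trans ih
      have : 0 ≤ c * x ^ d := by
        rcases h with h | h
        · obtain ⟨k, rfl⟩ := h
          rw [show c * x ^ (2 * k + 1) = c * x * (x ^ k) ^ 2 by ring]
          positivity
        · have : 0 ≤ x := nonneg_of_mul_nonneg_right hcx h
          positivity
      linarith
  have h1 : |c| * |c| ≤ |c| * |(fun x : ℚ => x ^ d + c)^[n + 1] 0| := by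
    rw [← abs_mul, ← abs_mul, abs_of_nonneg (mul_self_nonneg c)]
    exact key.trans (le_abs_self _)
  exact le_of_mul_le_mul_left h1 (abs_pos.2 hc0)

lemma abs_le_abs_iterate_or_invariant (hd : 2 ≤ d) (hc0 : c ≠ 0) :
    (∀ n, |c| ≤ |(fun x : ℚ => x ^ d + c)^[n + 1] 0|) ∨
      (|c| ^ (d - 1) ≤ 2 ∧ ∀ x : ℚ, |x| ≤ |c| → |x ^ d + c| ≤ |c|) := by
  by_cases h1 : 2 ≤ |c| ^ (d - 1)
  · exact Or.inl (abs_le_abs_iterate_of_two_le hd h1)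
  by_cases h2 : Odd d ∨ 0 < c
  · exact Or.inl (abs_le_abs_iterate_of_odd_or_pos hd hc0 h2)
  push Not at h1 h2
  refine Or.inr ⟨h1.le, fun x hx => ?_⟩
  have hcneg : |c| = -c := abs_of_nonpos h2.2
  have hx0 : 0 ≤ x ^ d := (Nat.not_odd_iff_even.1 h2.1).pow_nonneg x
  have hx1 : x ^ d ≤ |c| ^ (d - 1) * |c| := by
    rw [← pow_succ, Nat.sub_add_cancel (by omega)]
    calc x ^ d ≤ |x ^ d| := le_abs_self _
      _ = |x| ^ d := abs_pow x d
      _ ≤ |c| ^ d := by gcongr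
  have hx2 : |c| ^ (d - 1) * |c| ≤ 2 * |c| := by gcongr
  rw [abs_le]
  constructor <;> linarith

lemma abs_iterate_sub_iterate_zero_le (hd : 2 ≤ d) {R : ℚ} (hR : R ^ (d - 1) ≤ 2)
    (hinv : ∀ x : ℚ, |x| ≤ R → |x ^ d + c| ≤ R) {x : ℚ} (hxR : |x| ≤ R) (hx1 : |x| ≤ 1) (j : ℕ) :
    |(fun x : ℚ => x ^ d + c)^[j + 1] x - (fun x : ℚ => x ^ d + c)^[j + 1] 0| ≤
      (2 * d : ℚ) ^ j * |x| ^ 2 := by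
  have horb : ∀ z : ℚ, |z| ≤ R → ∀ i, |(fun x : ℚ => x ^ d + c)^[i] z| ≤ R := by
    intro z hz i
    induction i with
    | zero => simpa using hz
    | succ i ih =>
      rw [Function.iterate_succ_apply']
      exact hinv _ ih
  have h0R : |(0 : ℚ)| ≤ R := by simpa using (abs_nonneg x).trans hxR
  induction j with
  | zero =>
    simp only [zero_add, Function.iterate_one, pow_zero, one_mul]
    rw [zero_pow (by omega), zero_add, add_sub_cancel_right, abs_pow]
    exact pow_le_pow_of_le_one (abs_nonneg x) hx1 hd
  | succ j ih =>
    have hu := horb x hxR (j + 1)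
    have hv := horb 0 h0R (j + 1)
    rw [Function.iterate_succ_apply' _ (j + 1) x, Function.iterate_succ_apply' _ (j + 1) 0]
    generalize (fun x : ℚ => x ^ d + c)^[j + 1] x = u at *
    generalize (fun x : ℚ => x ^ d + c)^[j + 1] 0 = v at *
    change |u ^ d + c - (v ^ d + c)| ≤ _
    rw [add_sub_add_right_eq_sub]
    have hmax : max |u| |v| ^ (d - 1) ≤ 2 :=
      (pow_le_pow_left₀ (le_max_of_le_left (abs_nonneg u)) (max_le hu hv) _).trans hR
    calc |u ^ d - v ^ d| ≤ |u - v| * d * max |u| |v| ^ (d - 1) := abs_pow_sub_pow_le ..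
      _ ≤ |u - v| * d * 2 := by gcongr
      _ = 2 * d * |u - v| := by ring
      _ ≤ 2 * d * ((2 * d : ℚ) ^ j * |x| ^ 2) := by gcongr
      _ = (2 * d : ℚ) ^ (j + 1) * |x| ^ 2 := by ring

/-- If the critical point returns very close to itself, the critical orbit is attracted to a
cycle and never again comes substantially closer to the critical point. -/
lemma le_two_mul_abs_iterate (hd : 2 ≤ d) {R ε : ℚ} (hR : R ^ (d - 1) ≤ 2)
    (hinv : ∀ x : ℚ, |x| ≤ R → |x ^ d + c| ≤ R) {n : ℕ}
    (hn : |(fun x : ℚ => x ^ d + c)^[n + 1] 0| ≤ ε)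
    (hbelow : ∀ j ≤ n, ε ≤ |(fun x : ℚ => x ^ d + c)^[j + 1] 0|)
    (hεR : 2 * ε ≤ R) (hε1 : 2 * ε ≤ 1) (hε : 8 * (2 * d : ℚ) ^ n * ε ≤ 1) (m : ℕ) :
    ε ≤ 2 * |(fun x : ℚ => x ^ d + c)^[m + 1] 0| := by
  have hε0 : 0 ≤ ε := (abs_nonneg _).trans hn
  have hpert : ∀ x : ℚ, |x| ≤ 2 * ε → ∀ j ≤ n,
      |(fun x : ℚ => x ^ d + c)^[j + 1] x - (fun x : ℚ => x ^ d + c)^[j + 1] 0| ≤ ε / 2 := by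
    intro x hx j hj
    refine (abs_iterate_sub_iterate_zero_le hd hR hinv (hx.trans hεR) (hx.trans hε1) j).trans ?_
    have hd1 : (1 : ℚ) ≤ 2 * d := by
      have : (2 : ℚ) ≤ d := by exact_mod_cast hd
      linarith
    calc (2 * d : ℚ) ^ j * |x| ^ 2 ≤ (2 * d : ℚ) ^ n * (2 * ε) ^ 2 := by gcongr
      _ = (8 * (2 * d : ℚ) ^ n * ε) * (ε / 2) := by ring
      _ ≤ 1 * (ε / 2) := by gcongr
      _ = ε / 2 := one_mul _
  have hret : ∀ k, |(fun x : ℚ => x ^ d + c)^[(n + 1) * k] 0| ≤ 2 * ε := by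
    intro k
    induction k with
    | zero => simpa using hε0
    | succ k ih =>
      rw [show (n + 1) * (k + 1) = (n + 1) + (n + 1) * k by ring, Function.iterate_add_apply]
      have h1 := hpert _ ih n le_rfl
      have h2 := abs_sub_abs_le_abs_sub
        ((fun x : ℚ => x ^ d + c)^[n + 1] ((fun x : ℚ => x ^ d + c)^[(n + 1) * k] 0))
        ((fun x : ℚ => x ^ d + c)^[n + 1] 0)
      linarith
  have hdecomp : m + 1 = (m % (n + 1) + 1) + (n + 1) * (m / (n + 1)) := by
    have := Nat.mod_add_div m (n + 1)
    omega
  have hj : m % (n + 1) ≤ n := Nat.le_of_lt_succ (Nat.mod_lt m (Nat.succ_pos n))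
  have h1 := hpert _ (hret (m / (n + 1))) _ hj
  rw [← Function.iterate_add_apply, ← hdecomp, abs_sub_comm] at h1
  have h2 := (abs_sub_abs_le_abs_sub _ _).trans h1
  linarith [hbelow _ hj]

lemma two_mul_pow_le_abs_iterate (hd : 2 ≤ d) (hc : 2 ≤ |c|) (n : ℕ) :
    2 * (|c| / 2) ^ d ^ n ≤ |(fun x : ℚ => x ^ d + c)^[n + 1] 0| := by
  induction n with
  | zero => simp [show d ≠ 0 by omega, mul_div_cancel₀]
  | succ n ih =>
    rw [Function.iterate_succ_apply']
    generalize (fun x : ℚ => x ^ d + c)^[n + 1] 0 = x at ih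
    have h1 : (2 * (|c| / 2) ^ d ^ n) ^ d ≤ |x ^ d| := by rw [abs_pow]; gcongr
    rw [mul_pow, ← pow_mul, ← pow_succ] at h1
    have h4 : (4 : ℚ) ≤ 2 ^ d := by
      calc (4 : ℚ) = 2 ^ 2 := by norm_num
        _ ≤ 2 ^ d := pow_le_pow_right₀ (by norm_num) hd
    have h5 : 4 * (|c| / 2) ^ d ^ (n + 1) ≤ 2 ^ d * (|c| / 2) ^ d ^ (n + 1) := by gcongr
    have h6 : |c| / 2 ≤ (|c| / 2) ^ d ^ (n + 1) :=
      le_self_pow₀ (by linarith) (by positivity)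
    have h7 := abs_sub_abs_le_abs_sub (x ^ d) (-c)
    rw [abs_neg, sub_neg_eq_add] at h7
    linarith

end Dynamics

section Bounds

variable {d : ℕ} {c : ℚ}

lemma thirty_two_mul_pow_le (hd : 2 ≤ d) {n : ℕ} (hn : 22 ≤ n) :
    32 * d ^ ((n + 1) / 2) ≤ d ^ (n - 1) := by
  calc 32 * d ^ ((n + 1) / 2) = 2 ^ 5 * d ^ ((n + 1) / 2) := by norm_num
    _ ≤ d ^ 5 * d ^ ((n + 1) / 2) := by gcongr
    _ = d ^ (5 + (n + 1) / 2) := (pow_add _ _ _).symm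
    _ ≤ d ^ (n - 1) := Nat.pow_le_pow_right (by omega) (by omega)

lemma notMem_kriegerZsig_of_two_le_abs (hd : 2 ≤ d) (hc : 2 ≤ |c|) (ha : 3 ≤ |c.num|)
    {n : ℕ} (hn : 22 ≤ n) : n + 1 ∉ kriegerZsig d c := by
  intro hmem
  have hb : (0 : ℚ) < c.den := by exact_mod_cast c.den_pos
  have hcb : |c| * c.den = |(c.num : ℚ)| := by
    conv_rhs => rw [← Rat.mul_den_eq_num c, abs_mul, abs_of_pos hb]
  have hlow : ∀ k, 2 * (|(c.num : ℚ)| / 2) ^ d ^ k ≤ ((|kriegerNum d c (k + 1)| : ℤ) : ℚ) := by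
    intro k
    rw [← abs_iterate_mul_den_pow hd, ← hcb, mul_div_right_comm, mul_pow, ← mul_assoc]
    gcongr
    exact two_mul_pow_le_abs_iterate hd hc k
  have haq : (3 : ℚ) ≤ |(c.num : ℚ)| := by exact_mod_cast ha
  have hne : ∀ k, kriegerNum d c (k + 1) ≠ 0 := by
    intro k hk
    have h1 := hlow k
    rw [hk] at h1
    have : 0 < 2 * (|(c.num : ℚ)| / 2) ^ d ^ k := by positivity
    simp at h1
    linarith
  have hden : (c.den : ℤ) ≤ |c.num| := by
    have : (c.den : ℚ) ≤ |(c.num : ℚ)| := by rw [← hcb]; nlinarith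
    exact_mod_cast this
  have hup := abs_kriegerNum_le_of_mem hd le_rfl hden hne hmem
  have hup' : ((|kriegerNum d c (n + 1)| : ℤ) : ℚ) ≤
      (2 * |(c.num : ℚ)|) ^ d ^ ((n + 1) / 2) := by exact_mod_cast hup
  have hN : 8 * d ^ ((n + 1) / 2) ≤ d ^ n :=
    (by omega : 8 * d ^ ((n + 1) / 2) ≤ 32 * d ^ ((n + 1) / 2)).trans
      ((thirty_two_mul_pow_le hd hn).trans (Nat.pow_le_pow_right (by omega) (by omega)))
  generalize |(c.num : ℚ)| = a at *
  have h8 : 2 * a ≤ (a / 2) ^ 8 := by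
    have h7 : (3 / 2 : ℚ) ^ 7 ≤ (a / 2) ^ 7 := by gcongr
    calc 2 * a ≤ (3 / 2 : ℚ) ^ 7 * (a / 2) := by norm_num; linarith
      _ ≤ (a / 2) ^ 7 * (a / 2) := by gcongr
      _ = (a / 2) ^ 8 := by ring
  have hchain : (2 * a) ^ d ^ ((n + 1) / 2) ≤ (a / 2) ^ d ^ n := by
    calc (2 * a) ^ d ^ ((n + 1) / 2) ≤ ((a / 2) ^ 8) ^ d ^ ((n + 1) / 2) := by gcongr
      _ = (a / 2) ^ (8 * d ^ ((n + 1) / 2)) := (pow_mul _ _ _).symm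
      _ ≤ (a / 2) ^ d ^ n := pow_le_pow_right₀ (by linarith) hN
  have : 0 < (a / 2) ^ d ^ n := by positivity
  linarith [hlow n]

lemma notMem_kriegerZsig_of_eq_one_or_two (hd : 2 ≤ d) (hc : c = 1 ∨ c = 2)
    {n : ℕ} (hn : 22 ≤ n) : n + 1 ∉ kriegerZsig d c := by
  intro hmem
  have hden : c.den = 1 := by rcases hc with rfl | rfl <;> rfl
  have hnum1 : 1 ≤ c.num := by rcases hc with rfl | rfl <;> decide
  have hnum2 : |c.num| ≤ 2 := by rcases hc with rfl | rfl <;> decide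
  have hrec : ∀ k, kriegerNum d c (k + 1) = kriegerNum d c k ^ d + c.num := by
    intro k
    rw [kriegerNum_succ hd, hden]
    simp
  have hA1 : kriegerNum d c 1 = c.num := by
    rw [hrec, kriegerNum_zero, zero_pow (by omega), zero_add]
  have hlow : ∀ k, 2 ^ d ^ k ≤ kriegerNum d c (k + 1 + 1) := by
    intro k
    induction k with
    | zero =>
      rw [hrec, hA1]
      have := one_le_pow₀ hnum1 (n := d)
      simp
      linarith
    | succ k ih =>
      rw [hrec, pow_succ, pow_mul]
      have := pow_le_pow_left₀ (by positivity) ih d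
      linarith
  have hne : ∀ k, kriegerNum d c (k + 1) ≠ 0 := by
    intro k
    rcases k with _ | k
    · rw [hA1]; omega
    · exact ((by positivity : (0 : ℤ) < 2 ^ d ^ k).trans_le (hlow k)).ne'
  have hup := abs_kriegerNum_le_of_mem hd hnum2 (by rw [hden]; norm_num) hne hmem
  obtain ⟨k, rfl⟩ : ∃ k, n = k + 1 := ⟨n - 1, by omega⟩
  have h32 := thirty_two_mul_pow_le hd hn
  rw [Nat.add_sub_cancel] at h32
  have hM : 0 < d ^ ((k + 1 + 1) / 2) := by positivity
  have h1 := (hlow k).trans ((le_abs_self _).trans hup)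
  rw [show (2 * 2 : ℤ) = 2 ^ 2 by norm_num, ← pow_mul,
    pow_le_pow_iff_right₀ (by norm_num)] at h1
  omega

lemma kriegerNum_ne_zero_of_two_le_den (hd : 2 ≤ d) (hb : 2 ≤ c.den) (n : ℕ) :
    kriegerNum d c (n + 1) ≠ 0 := by
  intro h0
  have h := isCoprime_kriegerNum_den (c := c) hd n
  rw [h0, isCoprime_zero_left, Int.isUnit_iff] at h
  omega

/-- At large Zsigmondy indices the critical orbit is extremely close to the critical point. -/
lemma exists_abs_iterate_mul_pow_le_one (hd : 2 ≤ d) (hb : 2 ≤ c.den)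
    (hc : |c| ≤ 2) {n : ℕ} (hn : 22 ≤ n) (hmem : n + 1 ∈ kriegerZsig d c) :
    ∃ e, 3 * d ^ n ≤ 4 * e ∧
      |(fun x : ℚ => x ^ d + c)^[n + 1] 0| * (c.den : ℚ) ^ e ≤ 1 := by
  have hb0 : (0 : ℚ) < c.den := by exact_mod_cast c.den_pos
  have hb2 : (2 : ℚ) ≤ c.den := by exact_mod_cast hb
  have hnum : |c.num| ≤ 2 * c.den := by
    have : |(c.num : ℚ)| ≤ 2 * c.den := by
      rw [← Rat.mul_den_eq_num c, abs_mul, abs_of_pos hb0]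
      gcongr
    exact_mod_cast this
  have hup := abs_kriegerNum_le_of_mem hd hnum (by omega)
    (kriegerNum_ne_zero_of_two_le_den hd hb) hmem
  have hup' : ((|kriegerNum d c (n + 1)| : ℤ) : ℚ) ≤
      (2 * (2 * c.den : ℚ)) ^ d ^ ((n + 1) / 2) := by exact_mod_cast hup
  rw [← abs_iterate_mul_den_pow hd] at hup'
  have hN : 32 * d ^ ((n + 1) / 2) ≤ d ^ n :=
    (thirty_two_mul_pow_le hd hn).trans (Nat.pow_le_pow_right (by omega) (by omega))
  refine ⟨d ^ n - 3 * d ^ ((n + 1) / 2), by omega, ?_⟩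
  have hcube : (2 * (2 * c.den : ℚ)) ≤ (c.den : ℚ) ^ 3 := by
    calc 2 * (2 * c.den : ℚ) ≤ c.den * (c.den * c.den) := by gcongr
      _ = (c.den : ℚ) ^ 3 := by ring
  have h1 : (2 * (2 * c.den : ℚ)) ^ d ^ ((n + 1) / 2) ≤
      1 * (c.den : ℚ) ^ (3 * d ^ ((n + 1) / 2)) := by
    rw [one_mul, pow_mul]
    gcongr
  have h2 := hup'.trans h1
  rw [← Nat.sub_add_cancel (show 3 * d ^ ((n + 1) / 2) ≤ d ^ n by omega), pow_add,
    ← mul_assoc] at h2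
  exact le_of_mul_le_mul_right h2 (by positivity)

lemma eight_mul_two_mul_pow_le (hd : 2 ≤ d) {n e : ℕ} (hn : 22 ≤ n) (he : 3 * d ^ n ≤ 4 * e) :
    8 * (2 * d) ^ n ≤ 2 ^ e := by
  have hlin : ∀ k, 21 ≤ k → 2 * k + 6 ≤ 2 ^ k := by
    intro k hk
    induction k, hk using Nat.le_induction with
    | base => norm_num
    | succ k hk ih => rw [pow_succ]; omega
  have h1 : 2 * d ≤ 2 ^ d := by
    induction d, hd using Nat.le_induction with
    | base => norm_num
    | succ k hk ih =>
      rw [pow_succ]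
      have := ih (le_trans (by gcongr; omega) he)
      omega
  have h2 : 3 + d * n ≤ e := by
    obtain ⟨k, rfl⟩ : ∃ k, n = k + 1 := ⟨n - 1, by omega⟩
    have h3 : d * (2 * k + 6) ≤ d * d ^ k := by
      gcongr
      exact (hlin k (by omega)).trans (Nat.pow_le_pow_left hd k)
    rw [← pow_succ'] at h3
    nlinarith
  calc 8 * (2 * d) ^ n ≤ 2 ^ 3 * (2 ^ d) ^ n := by gcongr; norm_num
    _ = 2 ^ (3 + d * n) := by rw [← pow_mul, ← pow_add]
    _ ≤ 2 ^ e := Nat.pow_le_pow_right (by norm_num) h2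

lemma one_le_abs_iterate_mul_den_pow (hd : 2 ≤ d) (hb : 2 ≤ c.den) (n : ℕ) :
    1 ≤ |(fun x : ℚ => x ^ d + c)^[n + 1] 0| * (c.den : ℚ) ^ d ^ n := by
  rw [abs_iterate_mul_den_pow hd]
  exact_mod_cast Int.one_le_abs (kriegerNum_ne_zero_of_two_le_den hd hb n)

lemma notMem_kriegerZsig_of_lt (hd : 2 ≤ d) (hc0 : c ≠ 0) (hb : 2 ≤ c.den)
    (hc : |c| ≤ 2) {n m : ℕ} (hn : 22 ≤ n) (hnm : n < m) (hmem : n + 1 ∈ kriegerZsig d c) :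
    m + 1 ∉ kriegerZsig d c := by
  intro hmem'
  have hb2 : (2 : ℚ) ≤ c.den := by exact_mod_cast hb
  have hb0 : (0 : ℚ) < c.den := by linarith
  obtain ⟨e, he, hε⟩ := exists_abs_iterate_mul_pow_le_one hd hb hc hn hmem
  obtain ⟨e', he', hε'⟩ := exists_abs_iterate_mul_pow_le_one hd hb hc (by omega) hmem'
  have hNbig : 4 ≤ d ^ n := by
    calc 4 ≤ 2 ^ n := (by norm_num : 4 ≤ 2 ^ 2).trans (Nat.pow_le_pow_right (by norm_num) (by omega))
      _ ≤ d ^ n := Nat.pow_le_pow_left hd n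
  have hc1 : 1 ≤ |c| * c.den := by
    have := one_le_abs_iterate_mul_den_pow hd hb 0
    simpa [show d ≠ 0 by omega] using this
  have hεb : |(fun x : ℚ => x ^ d + c)^[n + 1] 0| * ((c.den : ℚ) * c.den) ≤ 1 := by
    refine le_trans ?_ hε
    rw [← pow_two]
    gcongr
    · linarith
    · omega
  have hε2 : 2 * |(fun x : ℚ => x ^ d + c)^[n + 1] 0| * c.den ≤ 1 := by
    refine le_trans ?_ hεb
    rw [mul_comm 2, mul_assoc]
    gcongr
  have hεc : 2 * |(fun x : ℚ => x ^ d + c)^[n + 1] 0| ≤ |c| :=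
    le_of_mul_le_mul_right (hε2.trans hc1) hb0
  have hpos : 0 < |(fun x : ℚ => x ^ d + c)^[n + 1] 0| := by
    have := one_le_abs_iterate_mul_den_pow hd hb n
    exact pos_of_mul_pos_left (by linarith) (by positivity)
  rcases abs_le_abs_iterate_or_invariant hd hc0 with h | ⟨hR, hinv⟩
  · linarith [h n]
  have hlow := le_two_mul_abs_iterate hd hR hinv (n := n) le_rfl ?_ hεc ?_ ?_ m
  · have h1 := one_le_abs_iterate_mul_den_pow hd hb n
    have h2 : (c.den : ℚ) ^ e' ≤ (c.den : ℚ) ^ (d ^ n + 1) := by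
      calc (c.den : ℚ) ^ e'
          ≤ (|(fun x : ℚ => x ^ d + c)^[n + 1] 0| * (c.den : ℚ) ^ d ^ n) * (c.den : ℚ) ^ e' :=
            le_mul_of_one_le_left (by positivity) h1
        _ ≤ (2 * |(fun x : ℚ => x ^ d + c)^[m + 1] 0| * (c.den : ℚ) ^ d ^ n) *
              (c.den : ℚ) ^ e' := by gcongr
        _ = 2 * (c.den : ℚ) ^ d ^ n *
              (|(fun x : ℚ => x ^ d + c)^[m + 1] 0| * (c.den : ℚ) ^ e') := by ring
        _ ≤ 2 * (c.den : ℚ) ^ d ^ n * 1 := by gcongr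
        _ ≤ c.den * (c.den : ℚ) ^ d ^ n * 1 := by gcongr
        _ = (c.den : ℚ) ^ (d ^ n + 1) := by ring
    rw [pow_le_pow_iff_right₀ (by linarith)] at h2
    have h3 : 2 * d ^ n ≤ d ^ m := by
      calc 2 * d ^ n ≤ d * d ^ n := by gcongr
        _ = d ^ (n + 1) := (pow_succ' _ _).symm
        _ ≤ d ^ m := Nat.pow_le_pow_right (by omega) hnm
    omega
  · intro j hj
    rcases hj.eq_or_lt with rfl | hj
    · exact le_rfl
    have h1 := one_le_abs_iterate_mul_den_pow hd hb j
    have h2 : d ^ j ≤ e := by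
      have : 2 * d ^ j ≤ d ^ n := by
        calc 2 * d ^ j ≤ d * d ^ j := by gcongr
          _ = d ^ (j + 1) := (pow_succ' _ _).symm
          _ ≤ d ^ n := Nat.pow_le_pow_right (by omega) hj
      omega
    have h3 := (hε.trans h1).trans (mul_le_mul_of_nonneg_left
      (pow_le_pow_right₀ (by linarith) h2 : (c.den : ℚ) ^ d ^ j ≤ (c.den : ℚ) ^ e)
      (abs_nonneg _))
    exact le_of_mul_le_mul_right h3 (by positivity)
  · nlinarith
  · have h1 : (8 * (2 * d : ℚ) ^ n) ≤ 2 ^ e := by exact_mod_cast eight_mul_two_mul_pow_le hd hn he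
    calc 8 * (2 * d : ℚ) ^ n * |(fun x : ℚ => x ^ d + c)^[n + 1] 0|
        ≤ (c.den : ℚ) ^ e * |(fun x : ℚ => x ^ d + c)^[n + 1] 0| := by
          gcongr
          exact h1.trans (by gcongr)
      _ ≤ 1 := by rwa [mul_comm]

lemma notMem_kriegerZsig_of_mem_of_lt (hd : 2 ≤ d) (hc0 : c ≠ 0) (hc1 : c ≠ -1) (hc2 : c ≠ -2)
    {n m : ℕ} (hn : 23 ≤ n) (hnm : n < m) (hmem : n ∈ kriegerZsig d c) :
    m ∉ kriegerZsig d c := by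
  obtain ⟨n, rfl⟩ : ∃ k, n = k + 1 := ⟨n - 1, by omega⟩
  obtain ⟨m, rfl⟩ : ∃ k, m = k + 1 := ⟨m - 1, by omega⟩
  by_cases hb : 2 ≤ c.den
  · rcases le_total |c| 2 with hc | hc
    · exact notMem_kriegerZsig_of_lt hd hc0 hb hc (by omega) (by omega) hmem
    · refine notMem_kriegerZsig_of_two_le_abs hd hc ?_ (by omega)
      have hbq : (2 : ℚ) ≤ c.den := by exact_mod_cast hb
      have h1 : (3 : ℚ) ≤ |(c.num : ℚ)| := by
        rw [← Rat.mul_den_eq_num c, abs_mul, abs_of_nonneg (by positivity : (0 : ℚ) ≤ c.den)]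
        nlinarith
      exact_mod_cast h1
  · have hden : c.den = 1 := by have := c.den_pos; omega
    have hcz : (c.num : ℚ) = c := Rat.coe_int_num_of_den_eq_one hden
    by_cases h3 : 3 ≤ |c.num|
    · refine notMem_kriegerZsig_of_two_le_abs hd ?_ h3 (by omega)
      have h4 : (3 : ℚ) ≤ |(c.num : ℚ)| := by exact_mod_cast h3
      rw [hcz] at h4
      linarith
    · refine notMem_kriegerZsig_of_eq_one_or_two hd ?_ (by omega)
      have hlt := abs_lt.1 (not_le.1 h3)
      generalize c.num = a at *
      subst hcz
      obtain ⟨hl, hu⟩ := hlt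
      interval_cases a <;> simp_all

end Bounds

/-- Krieger: for d ≥ 2 and c ∈ ℚ with c ∉ {0, −1, −2}, the Zsigmondy set
of the sequence of numerators of the critical orbit of x^d + c has at most 23 elements. -/
theorem krieger_zsigmondy_bound (d : ℕ) (hd : 2 ≤ d) (c : ℚ)
    (hc0 : c ≠ 0) (hc1 : c ≠ -1) (hc2 : c ≠ -2) :
    (kriegerZsig d c).Finite ∧ (kriegerZsig d c).ncard ≤ 23 := by
  classical
  obtain ⟨N, hN⟩ : ∃ N, kriegerZsig d c ⊆ (insert N (Finset.Icc 1 22) : Finset ℕ) := by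
    by_cases h : ∃ N ∈ kriegerZsig d c, 23 ≤ N
    · obtain ⟨N, hNmem, hN⟩ := h
      refine ⟨N, fun m hm => ?_⟩
      have h1 := hm.1
      rw [Finset.mem_coe, Finset.mem_insert, Finset.mem_Icc]
      by_contra! hcon
      have hm23 : 23 ≤ m := by by_contra; have := hcon.2 h1; omega
      rcases lt_or_gt_of_ne hcon.1 with hlt | hlt
      · exact notMem_kriegerZsig_of_mem_of_lt hd hc0 hc1 hc2 hm23 hlt hm hNmem
      · exact notMem_kriegerZsig_of_mem_of_lt hd hc0 hc1 hc2 hN hlt hNmem hm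
    · push Not at h
      refine ⟨1, fun m hm => ?_⟩
      have h1 := hm.1
      have h2 := h m hm
      rw [Finset.mem_coe, Finset.mem_insert, Finset.mem_Icc]
      omega
  refine ⟨(Finset.finite_toSet _).subset hN, ?_⟩
  calc (kriegerZsig d c).ncard
      ≤ ((insert N (Finset.Icc 1 22) : Finset ℕ) : Set ℕ).ncard :=
        Set.ncard_le_ncard hN (Finset.finite_toSet _)
    _ = (insert N (Finset.Icc 1 22) : Finset ℕ).card := Set.ncard_coe_finset _
    _ ≤ (Finset.Icc 1 22).card + 1 := Finset.card_insert_le _ _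
    _ = 23 := by simp
end
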